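/- arXiv:1508.01792 — 9 statements merged into one kernel-verified Lean document; each statement's English description precedes it below -/
import Mathlib

section
/- Let s ∈ ℂ[x₀,x₁,x₂,x₃] be a homogeneous polynomial of degree 3 such that the only common zero in ℂ⁴ of its four partial derivatives ∂s/∂x₀, …, ∂s/∂x₃ is the origin. Then for every α ∈ ℂ the polynomial s − α·x₀³ is irreducible in ℂ[x₀,x₁,x₂,x₃]. (Equivalently: every member of the pencil generated by the smooth cubic surface S = {s = 0} ⊂ ℙ³ and 3H, where H = {x₀ = 0}, other than the member 3H itself, is an irreducible and reduced surface — Lemma 1.3, case of degree 3.) -/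
open MvPolynomial

lemma aux_hc_mul (a b : MvPolynomial (Fin 4) ℂ) (m n : ℕ) (ha : a.totalDegree ≤ m)
    (hb : b.totalDegree ≤ n) :
    homogeneousComponent (m + n) (a * b)
      = homogeneousComponent m a * homogeneousComponent n b := by
  classical
  have hz : ∀ (p : MvPolynomial (Fin 4) ℂ) (k : ℕ) (d : Fin 4 →₀ ℕ), p.totalDegree ≤ k →
      k < d.degree → coeff d p = 0 := by
    intro p k d hp hd
    apply coeff_eq_zero_of_totalDegree_lt
    have : d.degree = ∑ i ∈ d.support, d i := rfl
    omega
  ext d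
  rw [coeff_homogeneousComponent]
  split_ifs with hd
  · rw [coeff_mul, coeff_mul]
    apply Finset.sum_congr rfl
    rintro ⟨x, y⟩ hxy
    rw [Finset.HasAntidiagonal.mem_antidiagonal] at hxy
    simp only at hxy ⊢
    have hdeg : x.degree + y.degree = m + n := by
      rw [← hd, ← hxy]; simp
    rw [coeff_homogeneousComponent, coeff_homogeneousComponent]
    rcases lt_trichotomy x.degree m with h | h | h
    · rw [hz b n y hb (by omega)]; simp
    · rw [if_pos h, if_pos (by omega)]
    · rw [hz a m x ha h]; simp
  · exact (((homogeneousComponent_isHomogeneous m a).mul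
      (homogeneousComponent_isHomogeneous n b)).coeff_eq_zero hd).symm

lemma aux_eval_smul (q : MvPolynomial (Fin 4) ℂ) (n : ℕ) (hq : q.IsHomogeneous n)
    (c : ℂ) (p : Fin 4 → ℂ) : eval (c • p) q = c ^ n * eval p q := by
  rw [eval_eq, eval_eq, Finset.mul_sum]
  apply Finset.sum_congr rfl
  intro d hd
  have h := hq.degree_eq_sum_deg_support hd
  have h' : n = ∑ i ∈ d.support, d i := h
  simp only [Pi.smul_apply, smul_eq_mul, mul_pow, Finset.prod_mul_distrib]
  rw [Finset.prod_pow_eq_pow_sum, ← h']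
  ring

lemma aux_line (q : MvPolynomial (Fin 4) ℂ) (n : ℕ) (hn : n ≠ 0) (hq : q.IsHomogeneous n)
    (u v : Fin 4 → ℂ) : eval v q = 0 ∨ ∃ t : ℂ, eval (u + t • v) q = 0 := by
  by_contra hcon
  push Not at hcon
  obtain ⟨hv, ht⟩ := hcon
  let P : Polynomial ℂ := aeval (fun i => Polynomial.C (u i) + Polynomial.X * Polynomial.C (v i)) q
  let Q : Polynomial ℂ := aeval (fun i => Polynomial.X * Polynomial.C (u i) + Polynomial.C (v i)) q
  have hP : ∀ t, P.eval t = eval (u + t • v) q := by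
    intro t
    have : P.eval t = Polynomial.aeval t P := by simp [Polynomial.aeval_def]
    rw [this, ← MvPolynomial.aeval_eq_eval]
    simp only [P]
    rw [← AlgHom.comp_apply, comp_aeval]
    congr 2
    ext i
    simp
    ring
  have hQ : ∀ t, Q.eval t = eval (t • u + v) q := by
    intro t
    have : Q.eval t = Polynomial.aeval t Q := by simp [Polynomial.aeval_def]
    rw [this, ← MvPolynomial.aeval_eq_eval]
    simp only [Q]
    rw [← AlgHom.comp_apply, comp_aeval]
    congr 2
    ext i
    simp
    ring
  have hdeg : P.degree = 0 := by
    by_contra h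
    obtain ⟨t, h⟩ := IsAlgClosed.exists_root P h
    exact ht t (by rw [← hP]; exact h)
  have hc := Polynomial.eq_C_of_degree_eq_zero hdeg
  set c := P.coeff 0
  have hzero : Polynomial.X * (Q - Polynomial.C c * Polynomial.X ^ n) = 0 := by
    apply Polynomial.funext
    intro t
    by_cases h0 : t = 0
    · simp [h0]
    have h1 : eval (t • u + v) q = t ^ n * c := by
      have : t • u + v = t • (u + t⁻¹ • v) := by
        rw [smul_add, smul_smul, mul_inv_cancel₀ h0, one_smul]
      rw [this, aux_eval_smul q n hq, ← hP, hc]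
      simp
    simp [hQ, h1]
    right; ring
  have h2 : Q - Polynomial.C c * Polynomial.X ^ n = 0 :=
    (mul_eq_zero.mp hzero).resolve_left Polynomial.X_ne_zero
  have h3 := congrArg (Polynomial.eval 0) h2
  simp [hQ, hn] at h3
  exact hv h3

lemma aux_point (l q : MvPolynomial (Fin 4) ℂ) (hl : l.IsHomogeneous 1) (hq : q.IsHomogeneous 2) :
    ∃ p : Fin 4 → ℂ, p ≠ 0 ∧ p 0 = 0 ∧ eval p l = 0 ∧ eval p q = 0 := by
  have hlin : ∃ c : Fin 4 → ℂ, ∀ p, eval p l = ∑ i, p i * c i := by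
    refine ⟨fun i => coeff 0 (pderiv i l), fun p => ?_⟩
    have h := hl.sum_X_mul_pderiv
    rw [one_smul] at h
    conv_lhs => rw [← h]
    rw [map_sum]
    apply Finset.sum_congr rfl
    intro i _
    have h1 : (pderiv i l).IsHomogeneous 0 := hl.pderiv
    rw [← totalDegree_zero_iff_isHomogeneous, totalDegree_eq_zero_iff_eq_C] at h1
    rw [map_mul, eval_X]
    congr 1
    rw [h1]; simp
  obtain ⟨c, hc⟩ := hlin
  have huv : ∃ u v : Fin 4 → ℂ, v ≠ 0 ∧ (∀ t : ℂ, u + t • v ≠ 0) ∧ u 0 = 0 ∧ v 0 = 0 ∧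
      ∑ i, u i * c i = 0 ∧ ∑ i, v i * c i = 0 := by
    by_cases h1 : c 1 = 0
    · by_cases h2 : c 2 = 0
      · refine ⟨![0,1,0,0], ![0,0,1,0], fun h => ?_, fun t h => ?_, rfl, rfl, ?_, ?_⟩
        · simpa using congrFun h 2
        · simpa using congrFun h 1
        · simp [Fin.sum_univ_four, h1]
        · simp [Fin.sum_univ_four, h2]
      · refine ⟨![0,1,0,0], ![0,0,-c 3,c 2], fun h => ?_, fun t h => ?_, rfl, rfl, ?_, ?_⟩
        · exact h2 (by simpa using congrFun h 3)
        · simpa using congrFun h 1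
        · simp [Fin.sum_univ_four, h1]
        · simp [Fin.sum_univ_four]; ring
    · refine ⟨![0,-c 3,0,c 1], ![0,-c 2,c 1,0], fun h => ?_, fun t h => ?_, rfl, rfl, ?_, ?_⟩
      · exact h1 (by simpa using congrFun h 2)
      · exact h1 (by simpa using congrFun h 3)
      · simp [Fin.sum_univ_four]; ring
      · simp [Fin.sum_univ_four]; ring
  obtain ⟨u, v, hv, huv, hu0, hv0, hul, hvl⟩ := huv
  rcases aux_line q 2 two_ne_zero hq u v with h | ⟨t, h⟩
  · exact ⟨v, hv, hv0, by rw [hc, hvl], h⟩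
  · refine ⟨u + t • v, huv t, by simp [hu0, hv0], ?_, h⟩
    rw [hc]
    simp only [Pi.add_apply, Pi.smul_apply, smul_eq_mul, add_mul, Finset.sum_add_distrib, mul_assoc]
    rw [← Finset.mul_sum, hul, hvl]; simp

/-- Every member of the pencil generated by a smooth cubic surface `S = {s = 0} ⊂ ℙ³`
and `3H`, `H = {x₀ = 0}`, other than `3H` itself, is irreducible and reduced. -/
theorem pencil_member_irreducible_cubic
    (s : MvPolynomial (Fin 4) ℂ) (hs : s.IsHomogeneous 3)
    (hsmooth : ∀ p : Fin 4 → ℂ, (∀ i : Fin 4, eval p (pderiv i s) = 0) → p = 0) :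
    ∀ α : ℂ, Irreducible (s - C α * X 0 ^ 3) := by
  intro α
  have key : ∀ l q : MvPolynomial (Fin 4) ℂ, l.IsHomogeneous 1 → q.IsHomogeneous 2 →
      s - C α * X 0 ^ 3 = l * q → False := by
    intro l q hl hq h
    obtain ⟨p, hp, hp0, hpl, hpq⟩ := aux_point l q hl hq
    refine hp (hsmooth p fun i => ?_)
    rw [sub_eq_iff_eq_add.mp h]
    simp [Derivation.leibniz, Derivation.leibniz_pow, hp0, hpl, hpq]
  have hhom : (s - C α * X 0 ^ 3).IsHomogeneous 3 :=
    hs.sub (isHomogeneous_C_mul_X_pow _ _ _)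
  have hne : s - C α * X 0 ^ 3 ≠ 0 := fun h =>
    key 0 0 (isHomogeneous_zero _ _ _) (isHomogeneous_zero _ _ _) (by simpa using h)
  have htd := hhom.totalDegree hne
  have hunit : ∀ a : MvPolynomial (Fin 4) ℂ, a ≠ 0 → a.totalDegree = 0 → IsUnit a := by
    intro a ha h
    rw [totalDegree_eq_zero_iff_eq_C] at h
    rw [h]
    apply IsUnit.map
    rw [isUnit_iff_ne_zero]
    intro h0
    rw [h0] at h
    exact ha (by simpa using h)
  refine ⟨fun h => ?_, fun a b hab => ?_⟩
  · rw [isUnit_iff_totalDegree_of_isReduced] at h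
    omega
  · have ha : a ≠ 0 := by rintro rfl; exact hne (by simpa using hab)
    have hb : b ≠ 0 := by rintro rfl; exact hne (by simpa using hab)
    have hsum : a.totalDegree + b.totalDegree = 3 := by
      rw [← totalDegree_mul_of_isDomain ha hb, ← hab, htd]
    have hf : s - C α * X 0 ^ 3 = homogeneousComponent a.totalDegree a *
        homogeneousComponent b.totalDegree b := by
      rw [← aux_hc_mul a b _ _ le_rfl le_rfl, hsum, ← hab]
      exact (homogeneousComponent_eq_self hhom).symm
    have hA := homogeneousComponent_isHomogeneous a.totalDegree a
    have hB := homogeneousComponent_isHomogeneous b.totalDegree b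
    have hcases : a.totalDegree = 0 ∨ b.totalDegree = 0 ∨
        (a.totalDegree = 1 ∧ b.totalDegree = 2) ∨ (a.totalDegree = 2 ∧ b.totalDegree = 1) := by
      omega
    rcases hcases with h | h | ⟨h1, h2⟩ | ⟨h1, h2⟩
    · exact Or.inl (hunit a ha h)
    · exact Or.inr (hunit b hb h)
    · rw [h1, h2] at hf
      rw [h1] at hA
      rw [h2] at hB
      exact (key _ _ hA hB hf).elim
    · rw [h1, h2] at hf
      rw [h1] at hA
      rw [h2] at hB
      exact (key _ _ hB hA (by rw [hf, mul_comm])).elim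
end

section
/- Grade ℂ[x,y,z,w] by assigning the variables x, y, z, w the weights 1, 1, 1, 2, and let s ∈ ℂ[x,y,z,w] be weighted homogeneous of degree 4 such that the only common zero in ℂ⁴ of its four partial derivatives is the origin. Then for every α ∈ ℂ the polynomial s − α·x⁴ is irreducible in ℂ[x,y,z,w]. (Equivalently: every member of the pencil generated by the smooth quartic surface S = {s = 0} ⊂ ℙ(1,1,1,2) and 4H, where H = {x = 0}, other than the member 4H itself, is irreducible and reduced — Lemma 1.3, case of degree 2.) -/
open MvPolynomial

lemma aux_scale {σ : Type*} {n : ℕ} {D : MvPolynomial σ ℂ} (hD : D.IsHomogeneous n)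
    (t : ℂ) (p : σ → ℂ) : eval (t • p) D = t ^ n * eval p D := by
  rw [eval_eq, eval_eq, Finset.mul_sum]
  refine Finset.sum_congr rfl fun d hd => ?_
  have h1 : d.degree = n := by
    have := hD (mem_support_iff.mp hd)
    rwa [Finsupp.degree_eq_weight_one]
  simp only [Pi.smul_apply, smul_eq_mul, mul_pow, Finset.prod_mul_distrib,
    Finset.prod_pow_eq_pow_sum]
  have h2 : ∑ i ∈ d.support, d i = n := by rw [← h1]; rfl
  rw [h2]; ring

lemma aux_eval_zero {σ : Type*} {n : ℕ} {D : MvPolynomial σ ℂ} (hD : D.IsHomogeneous n)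
    (hn : n ≠ 0) : eval 0 D = 0 := by
  have := aux_scale hD 0 0
  simpa [hn] using this

lemma aux_zero {n : ℕ} {D : MvPolynomial (Fin 3) ℂ} (hD : D.IsHomogeneous n) (hn : n ≠ 0) :
    ∃ p : Fin 3 → ℂ, p ≠ 0 ∧ p 0 = 0 ∧ eval p D = 0 := by
  let e : Polynomial ℂ := aeval ![0, 1, Polynomial.X] D
  let f : Polynomial ℂ := aeval ![0, Polynomial.X, 1] D
  have he : ∀ u, e.eval u = eval ![0, 1, u] D := by
    intro u
    have : (Polynomial.aeval u).comp (aeval ![0, 1, Polynomial.X]) =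
        (aeval ![0, 1, u] : MvPolynomial (Fin 3) ℂ →ₐ[ℂ] ℂ) := by
      ext i; fin_cases i <;> simp
    simpa [e, aeval_eq_eval] using! DFunLike.congr_fun this D
  have hf : ∀ u, f.eval u = eval ![0, u, 1] D := by
    intro u
    have : (Polynomial.aeval u).comp (aeval ![0, Polynomial.X, 1]) =
        (aeval ![0, u, 1] : MvPolynomial (Fin 3) ℂ →ₐ[ℂ] ℂ) := by
      ext i; fin_cases i <;> simp
    simpa [f, aeval_eq_eval] using! DFunLike.congr_fun this D
  by_cases hr : ∃ u, e.eval u = 0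
  · obtain ⟨u, hu⟩ := hr
    refine ⟨![0, 1, u], fun h => ?_, rfl, by rw [← he, hu]⟩
    simpa using congr_fun h 1
  · have hdeg : e.degree = 0 := by
      by_contra h
      exact hr (IsAlgClosed.exists_root e h)
    rw [Polynomial.eq_C_of_degree_eq_zero hdeg] at he
    simp only [Polynomial.eval_C] at he
    have hfe : f = Polynomial.C (e.coeff 0) * Polynomial.X ^ n := by
      apply Polynomial.eq_of_infinite_eval_eq
      refine Set.Infinite.mono ?_ (Set.Finite.infinite_compl (Set.finite_singleton (0 : ℂ)))
      intro u hu
      have hu' : u ≠ 0 := hu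
      have : (![0, u, 1] : Fin 3 → ℂ) = u • ![0, 1, u⁻¹] := by
        ext i; fin_cases i <;> simp [hu']
      show f.eval u = _
      rw [hf, this, aux_scale hD, ← he]
      rw [Polynomial.eval_mul, Polynomial.eval_C, Polynomial.eval_pow, Polynomial.eval_X, mul_comm]
    refine ⟨![0, 0, 1], fun h => ?_, rfl, ?_⟩
    · simpa using congr_fun h 2
    · rw [← hf, hfe]; simp [hn]

lemma aux_decomp {s : MvPolynomial (Fin 4) ℂ}
    (hs : s.IsWeightedHomogeneous ![1, 1, 1, 2] 4) :
    ∃ (c : ℂ) (q g : MvPolynomial (Fin 3) ℂ), q.IsHomogeneous 2 ∧ g.IsHomogeneous 4 ∧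
      s = C c * X 3 ^ 2 + rename Fin.castSucc q * X 3 + rename Fin.castSucc g := by
  induction hs using IsWeightedHomogeneous.induction_on with
  | zero => exact ⟨0, 0, 0, isHomogeneous_zero _ _ _, isHomogeneous_zero _ _ _, by simp⟩
  | add p p' hp hp' h h' =>
    obtain ⟨c, q, g, hq, hg, e⟩ := h
    obtain ⟨c', q', g', hq', hg', e'⟩ := h'
    refine ⟨c + c', q + q', g + g', hq.add hq', hg.add hg', ?_⟩
    rw [e, e']; simp only [map_add]; ring
  | monomial d r hr =>
    have hw : d 0 + d 1 + d 2 + 2 * d 3 = 4 := by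
      rw [Finsupp.weight_apply, Finsupp.sum_fintype _ _ (by simp)] at hr
      simp [Fin.sum_univ_four] at hr
      omega
    have hm : monomial d r = C r * (X 0 ^ d 0 * X 1 ^ d 1 * X 2 ^ d 2) * X 3 ^ d 3 := by
      rw [monomial_eq, Finsupp.prod_fintype _ _ (by simp), Fin.prod_univ_four]; ring
    let M : MvPolynomial (Fin 3) ℂ := C r * (X 0 ^ d 0 * X 1 ^ d 1 * X 2 ^ d 2)
    have hM : M.IsHomogeneous (d 0 + d 1 + d 2) := by
      have := (isHomogeneous_C (Fin 3) r).mul ((((isHomogeneous_X ℂ (0 : Fin 3)).pow (d 0)).mul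
        ((isHomogeneous_X ℂ (1 : Fin 3)).pow (d 1))).mul
        ((isHomogeneous_X ℂ (2 : Fin 3)).pow (d 2)))
      simpa using this
    have hMr : rename Fin.castSucc M = C r * (X 0 ^ d 0 * X 1 ^ d 1 * X 2 ^ d 2) := by
      simp [M]
    rw [hm, ← hMr]
    have h3 : d 3 = 0 ∨ d 3 = 1 ∨ d 3 = 2 := by omega
    rcases h3 with h | h | h
    · refine ⟨0, 0, M, isHomogeneous_zero _ _ _, ?_, by simp [h]⟩
      convert hM using 1; omega
    · refine ⟨0, M, 0, ?_, isHomogeneous_zero _ _ _, by simp [h]⟩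
      convert hM using 1; omega
    · refine ⟨r, 0, 0, isHomogeneous_zero _ _ _, isHomogeneous_zero _ _ _, ?_⟩
      have h0 : d 0 = 0 := by omega
      have h1 : d 1 = 0 := by omega
      have h2 : d 2 = 0 := by omega
      simp [M, h, h0, h1, h2]

lemma aux_pderiv_last (q : MvPolynomial (Fin 3) ℂ) :
    pderiv (3 : Fin 4) (rename Fin.castSucc q) = 0 := by
  apply pderiv_eq_zero_of_notMem_vars
  intro h
  have := vars_rename Fin.castSucc q h
  rw [Finset.mem_image] at this
  obtain ⟨j, -, hj⟩ := this
  exact (Fin.castSucc_lt_last j).ne hj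

noncomputable def auxEquiv : MvPolynomial (Fin 4) ℂ ≃ₐ[ℂ] Polynomial (MvPolynomial (Fin 3) ℂ) :=
  (renameEquiv ℂ (finRotate 4)).trans (finSuccEquiv ℂ 3)

lemma auxEquiv_X : auxEquiv (X 3) = Polynomial.X := by
  have : finRotate 4 3 = 0 := by decide
  simp [auxEquiv, this, finSuccEquiv_X_zero]

lemma auxEquiv_rename (q : MvPolynomial (Fin 3) ℂ) :
    auxEquiv (rename Fin.castSucc q) = Polynomial.C q := by
  have h : ∀ j : Fin 3, finRotate 4 j.castSucc = j.succ := by decide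
  induction q using MvPolynomial.induction_on with
  | C a => simp [auxEquiv, finSuccEquiv_apply]
  | add p q hp hq => simp [hp, hq]
  | mul_X p i hp =>
    have hX : auxEquiv (X i.castSucc) = Polynomial.C (X i) := by
      simp only [auxEquiv, AlgEquiv.trans_apply, renameEquiv_apply, rename_X, h]
      exact finSuccEquiv_X_succ
    rw [Polynomial.C_mul, ← hp, ← hX, ← map_mul, map_mul (rename _), rename_X]

lemma aux_irred {c : ℂ} (hc : c ≠ 0) (q g : MvPolynomial (Fin 3) ℂ)
    (h : ¬ Irreducible (C c * X 3 ^ 2 + rename Fin.castSucc q * X 3 + rename Fin.castSucc g :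
      MvPolynomial (Fin 4) ℂ)) :
    ∃ a : MvPolynomial (Fin 3) ℂ, C c * a ^ 2 + q * a + g = 0 := by
  have hcc : (C c⁻¹ * C c : MvPolynomial (Fin 3) ℂ) = 1 := by
    rw [← C_mul, inv_mul_cancel₀ hc, C_1]
  let P : Polynomial (MvPolynomial (Fin 3) ℂ) :=
    Polynomial.X ^ 2 + (Polynomial.C (C c⁻¹ * q) * Polynomial.X + Polynomial.C (C c⁻¹ * g))
  have hlt : (Polynomial.C (C c⁻¹ * q) * Polynomial.X + Polynomial.C (C c⁻¹ * g)).degree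
      < ((2 : ℕ) : WithBot ℕ) :=
    lt_of_le_of_lt Polynomial.degree_linear_le (by norm_num)
  have hPm : P.Monic := Polynomial.monic_X_pow_add hlt
  have hPd : P.natDegree = 2 := by
    have : P.degree = ((2 : ℕ) : WithBot ℕ) := by
      rw [Polynomial.degree_add_eq_left_of_degree_lt, Polynomial.degree_X_pow]
      rwa [Polynomial.degree_X_pow]
    exact Polynomial.natDegree_eq_of_degree_eq_some this
  have himg : auxEquiv (C c * X 3 ^ 2 + rename Fin.castSucc q * X 3 + rename Fin.castSucc g)
      = Polynomial.C (C c) * P := by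
    have hC : (C c : MvPolynomial (Fin 4) ℂ) = rename Fin.castSucc (C c) := by simp
    rw [hC]
    simp only [map_add, map_mul, map_pow, auxEquiv_rename, P]
    erw [auxEquiv_X]
    have : (Polynomial.C (C c⁻¹) * Polynomial.C (C c) :
        Polynomial (MvPolynomial (Fin 3) ℂ)) = 1 := by
      rw [← Polynomial.C_mul, hcc, Polynomial.C_1]
    linear_combination (-(Polynomial.C q * Polynomial.X) - Polynomial.C g) * this
  have hu : IsUnit (Polynomial.C (C c) : Polynomial (MvPolynomial (Fin 3) ℂ)) :=
    ((isUnit_iff_ne_zero.mpr hc).map C).map Polynomial.C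
  have hPi : ¬ Irreducible P := by
    intro hP
    apply h
    rw [← MulEquiv.irreducible_iff auxEquiv, himg]
    exact (irreducible_isUnit_mul hu).mpr hP
  rw [hPm.irreducible_iff_roots_eq_zero_of_degree_le_three hPd.ge (by omega)] at hPi
  obtain ⟨a, ha⟩ := Multiset.exists_mem_of_ne_zero hPi
  have hr := Polynomial.isRoot_of_mem_roots ha
  refine ⟨a, ?_⟩
  simp only [P, Polynomial.IsRoot.def, Polynomial.eval_add, Polynomial.eval_mul,
    Polynomial.eval_pow, Polynomial.eval_X, Polynomial.eval_C] at hr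
  linear_combination C c * hr - (q * a + g) * hcc

/-- Every member of the pencil generated by a smooth quartic `S = {s = 0} ⊂ ℙ(1,1,1,2)`
and `4H`, `H = {x = 0}`, other than `4H` itself, is irreducible and reduced. -/
theorem pencil_member_irreducible_quartic
    (s : MvPolynomial (Fin 4) ℂ)
    (hs : s.IsWeightedHomogeneous ![1, 1, 1, 2] 4)
    (hsmooth : ∀ p : Fin 4 → ℂ, (∀ i : Fin 4, eval p (pderiv i s) = 0) → p = 0) :
    ∀ α : ℂ, Irreducible (s - C α * X 0 ^ 4) := by
  intro α
  obtain ⟨c, q, g, hq, hg, rfl⟩ := aux_decomp hs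
  have hc : c ≠ 0 := by
    rintro rfl
    have := hsmooth ![0, 0, 0, 1] ?_
    · simpa using congr_fun this 3
    have h0 : (![0, 0, 0, 1] : Fin 4 → ℂ) ∘ Fin.castSucc = 0 := by
      ext j; fin_cases j <;> rfl
    have hq0 : eval 0 q = 0 := aux_eval_zero hq (by norm_num)
    rw [eval_zero] at hq0
    intro i
    induction i using Fin.lastCases with
    | last =>
      have e : Fin.last 3 = 3 := rfl
      rw [e]
      simp [Derivation.leibniz, aux_pderiv_last, eval_rename, h0, hq0]
    | cast j =>
      have hq' : eval 0 (pderiv j q) = 0 := aux_eval_zero hq.pderiv (by norm_num)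
      have hg' : eval 0 (pderiv j g) = 0 := aux_eval_zero hg.pderiv (by norm_num)
      rw [eval_zero] at hq' hg'
      simp [Derivation.leibniz, pderiv_rename (Fin.castSucc_injective 3), eval_rename, h0, hq0,
        hq', hg']
  by_contra hirr
  set g' : MvPolynomial (Fin 3) ℂ := g - C α * X 0 ^ 4 with hg'
  have hgh : g'.IsHomogeneous 4 := by
    refine hg.sub ?_
    simpa using (isHomogeneous_C (Fin 3) α).mul ((isHomogeneous_X ℂ (0 : Fin 3)).pow 4)
  have hren : rename Fin.castSucc g' = rename Fin.castSucc g - C α * X (0 : Fin 4) ^ 4 := by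
    simp [hg']
  obtain ⟨a, ha⟩ := aux_irred hc q g' (by
    rw [hren]; convert hirr using 2; ring)
  have hD : (q ^ 2 - C (4 * c) * g').IsHomogeneous 4 := by
    refine IsHomogeneous.sub (by simpa using hq.pow 2) ?_
    simpa using (isHomogeneous_C (Fin 3) (4 * c)).mul hgh
  obtain ⟨p, hp, hp0, hpD⟩ := aux_zero hD (by norm_num)
  have hsq : eval p (2 * C c * a + q) = 0 := by
    have : (2 * C c * a + q) ^ 2 = q ^ 2 - C (4 * c) * g' := by
      have h4 : (C (4 * c) : MvPolynomial (Fin 3) ℂ) = 4 * C c := by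
        rw [C_mul]; congr 1
      rw [h4]
      linear_combination 4 * C c * ha
    have h2 := congr_arg (eval p) this
    rw [hpD, map_pow] at h2
    exact pow_eq_zero_iff (two_ne_zero) |>.mp h2
  have hcc : (C c⁻¹ * C c : MvPolynomial (Fin 3) ℂ) = 1 := by
    rw [← C_mul, inv_mul_cancel₀ hc, C_1]
  let b : MvPolynomial (Fin 3) ℂ := - C c⁻¹ * q - a
  have hq_eq : q = - C c * (a + b) := by
    simp only [b]; linear_combination -q * hcc
  have hg_eq : g' = C c * (a * b) := by
    rw [hq_eq] at ha
    linear_combination ha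
  have hab : eval p a = eval p b := by
    rw [hq_eq] at hsq
    simp only [map_add, map_mul, map_neg, eval_C, map_ofNat] at hsq
    have : c * (eval p a - eval p b) = 0 := by linear_combination hsq
    exact sub_eq_zero.mp ((mul_eq_zero.mp this).resolve_left hc)
  have key : C c * X 3 ^ 2 + rename Fin.castSucc q * X 3 + rename Fin.castSucc g
      = C c * ((X 3 - rename Fin.castSucc a) * (X 3 - rename Fin.castSucc b))
        + C α * X (0 : Fin 4) ^ 4 := by
    have h1 := congr_arg (rename (Fin.castSucc : Fin 3 → Fin 4)) hq_eq
    have h2 := congr_arg (rename (Fin.castSucc : Fin 3 → Fin 4)) hg_eq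
    rw [hren] at h2
    simp only [map_add, map_mul, map_neg, rename_C] at h1 h2
    linear_combination h1 * X 3 + h2
  let P : Fin 4 → ℂ := Fin.snoc p (eval p a)
  have hPc : P ∘ Fin.castSucc = p := by
    ext j; simp [P]
  have hP3 : P 3 = eval p a := Fin.snoc_last (α := fun _ => ℂ) (eval p a) p
  have hP0 : P 0 = 0 := by
    rw [← hp0]; exact congr_fun hPc 0
  have hPz := hsmooth P (by
    intro i
    rw [key]
    simp [Derivation.leibniz, eval_rename, hPc, hP3, hP0, hab])
  apply hp
  rw [← hPc, hPz]; rfl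
end

section
/- Grade ℂ[x,y,z,w] by assigning the variables x, y, z, w the weights 1, 1, 2, 3, and let s ∈ ℂ[x,y,z,w] be weighted homogeneous of degree 6 such that the only common zero in ℂ⁴ of its four partial derivatives is the origin. Then for every α ∈ ℂ the polynomial s − α·x⁶ is irreducible in ℂ[x,y,z,w]. (Equivalently: every member of the pencil generated by the smooth sextic surface S = {s = 0} ⊂ ℙ(1,1,2,3) and 6H, where H = {x = 0}, other than the member 6H itself, is irreducible and reduced — Lemma 1.3, case of degree 1.) -/
open MvPolynomial

lemma wt_eq (d : Fin 4 →₀ ℕ) :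
    Finsupp.weight (![1, 1, 2, 3] : Fin 4 → ℕ) d = d 0 + d 1 + 2 * d 2 + 3 * d 3 := by
  rw [Finsupp.weight_apply, Finsupp.sum_fintype _ _ (by simp)]
  simp [Fin.sum_univ_four]
  ring

lemma eval_zero3 (g : MvPolynomial (Fin 4) ℂ) (n : ℕ)
    (hg : g.IsWeightedHomogeneous ![1, 1, 2, 3] n) (hn : n % 3 ≠ 0) :
    eval ![0, 0, 0, 1] g = 0 := by
  rw [eval_eq']
  refine Finset.sum_eq_zero fun d hd => ?_
  have h := hg (mem_support_iff.1 hd)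
  rw [wt_eq] at h
  have h' : d 0 ≠ 0 ∨ d 1 ≠ 0 ∨ d 2 ≠ 0 := by omega
  rcases h' with h' | h' | h' <;> simp [Fin.prod_univ_four, h']

lemma eval_zero2 (g : MvPolynomial (Fin 4) ℂ) (n : ℕ)
    (hg : g.IsWeightedHomogeneous ![1, 1, 2, 3] n) (hn : n % 2 ≠ 0) :
    eval ![0, 0, 1, 0] g = 0 := by
  rw [eval_eq']
  refine Finset.sum_eq_zero fun d hd => ?_
  have h := hg (mem_support_iff.1 hd)
  rw [wt_eq] at h
  have h' : d 0 ≠ 0 ∨ d 1 ≠ 0 ∨ d 3 ≠ 0 := by omega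
  rcases h' with h' | h' | h' <;> simp [Fin.prod_univ_four, h']

lemma aeval_restrict {A : Type*} [CommRing A] [Algebra ℂ A] (f : MvPolynomial (Fin 4) ℂ)
    (hf : f.IsWeightedHomogeneous ![1, 1, 2, 3] 6) (a b : A) :
    aeval ![0, 0, a, b] f = algebraMap ℂ A (coeff (Finsupp.single 3 2) f) * b ^ 2
      + algebraMap ℂ A (coeff (Finsupp.single 2 3) f) * a ^ 3 := by
  classical
  have hne : (Finsupp.single 3 2 : Fin 4 →₀ ℕ) ≠ Finsupp.single 2 3 := by
    intro h
    have := DFunLike.congr_fun h 3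
    simp at this
  rw [aeval_def, eval₂_eq']
  have key : ∀ d : Fin 4 →₀ ℕ, d ∉ ({Finsupp.single 3 2, Finsupp.single 2 3} : Finset _) →
      algebraMap ℂ A (coeff d f) * ∏ i, (![0, 0, a, b] : Fin 4 → A) i ^ d i = 0 := by
    intro d hd
    by_cases hc : coeff d f = 0
    · simp [hc]
    have h := hf hc
    rw [wt_eq] at h
    have h' : d 0 ≠ 0 ∨ d 1 ≠ 0 := by
      by_contra! h0
      apply hd
      rw [Finset.mem_insert, Finset.mem_singleton]
      have h23 : (d 2 = 0 ∧ d 3 = 2) ∨ (d 2 = 3 ∧ d 3 = 0) := by omega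
      rcases h23 with h23 | h23
      · left; ext i; fin_cases i <;> simp [h0, h23]
      · right; ext i; fin_cases i <;> simp [h0, h23]
    rcases h' with h' | h' <;> simp [Fin.prod_univ_four, h']
  have e1 : ∑ d ∈ f.support, algebraMap ℂ A (coeff d f) *
        ∏ i, (![0, 0, a, b] : Fin 4 → A) i ^ d i
      = ∑ d ∈ f.support ∪ {Finsupp.single 3 2, Finsupp.single 2 3},
        algebraMap ℂ A (coeff d f) * ∏ i, (![0, 0, a, b] : Fin 4 → A) i ^ d i := by
    refine Finset.sum_subset Finset.subset_union_left fun d _ hd => ?_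
    rw [notMem_support_iff.1 hd]; simp
  rw [e1, ← Finset.sum_subset Finset.subset_union_right fun d _ hd => key d hd,
    Finset.sum_pair hne]
  simp [Fin.prod_univ_four]

lemma coeffs_ne (s : MvPolynomial (Fin 4) ℂ)
    (hs : s.IsWeightedHomogeneous ![1, 1, 2, 3] 6)
    (hsmooth : ∀ p : Fin 4 → ℂ, (∀ i : Fin 4, eval p (pderiv i s) = 0) → p = 0) :
    coeff (Finsupp.single 3 2) s ≠ 0 ∧ coeff (Finsupp.single 2 3) s ≠ 0 := by
  have d0 : (pderiv 0 s).IsWeightedHomogeneous ![1, 1, 2, 3] 5 := hs.pderiv (by simp)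
  have d1 : (pderiv 1 s).IsWeightedHomogeneous ![1, 1, 2, 3] 5 := hs.pderiv (by simp)
  have d2 : (pderiv 2 s).IsWeightedHomogeneous ![1, 1, 2, 3] 4 := hs.pderiv (by simp)
  have d3 : (pderiv 3 s).IsWeightedHomogeneous ![1, 1, 2, 3] 3 := hs.pderiv (by simp)
  have eul := hs.sum_weight_X_mul_pderiv
  rw [Fin.sum_univ_four] at eul
  constructor
  · intro hc
    have hr := aeval_restrict s hs (0 : ℂ) 1
    have he := congrArg (eval ![0, 0, 0, 1]) eul
    rw [aeval_eq_eval] at hr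
    simp [hc] at hr
    simp [hr] at he
    have := hsmooth ![0, 0, 0, 1] (fun i => by
      fin_cases i
      · exact eval_zero3 _ _ d0 (by norm_num)
      · exact eval_zero3 _ _ d1 (by norm_num)
      · exact eval_zero3 _ _ d2 (by norm_num)
      · exact he)
    simpa using congrFun this 3
  · intro hc
    have hr := aeval_restrict s hs (1 : ℂ) 0
    have he := congrArg (eval ![0, 0, 1, 0]) eul
    rw [aeval_eq_eval] at hr
    simp [hc] at hr
    simp [hr] at he
    have := hsmooth ![0, 0, 1, 0] (fun i => by
      fin_cases i
      · exact eval_zero2 _ _ d0 (by norm_num)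
      · exact eval_zero2 _ _ d1 (by norm_num)
      · exact he
      · exact eval_zero2 _ _ d3 (by norm_num))
    simpa using congrFun this 2

/-- View as a polynomial in the last variable. -/
noncomputable def lastEquiv :
    MvPolynomial (Fin 4) ℂ ≃ₐ[ℂ] Polynomial (MvPolynomial (Fin 3) ℂ) :=
  (renameEquiv ℂ (Equiv.swap (0 : Fin 4) 3)).trans (finSuccEquiv ℂ 3)

lemma coeff_lastEquiv (f : MvPolynomial (Fin 4) ℂ) (i : ℕ) (m : Fin 3 →₀ ℕ) :
    coeff m ((lastEquiv f).coeff i) =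
      coeff (Finsupp.mapDomain (Equiv.swap (0 : Fin 4) 3) (m.cons i)) f := by
  have h : m.cons i = Finsupp.mapDomain (Equiv.swap (0 : Fin 4) 3)
      (Finsupp.mapDomain (Equiv.swap (0 : Fin 4) 3) (m.cons i)) := by
    rw [← Finsupp.mapDomain_comp]
    have : (Equiv.swap (0 : Fin 4) 3 : Fin 4 → Fin 4) ∘ (Equiv.swap (0 : Fin 4) 3) = id := by
      ext x; simp
    rw [this, Finsupp.mapDomain_id]
  simp only [lastEquiv, AlgEquiv.trans_apply, renameEquiv_apply]
  rw [finSuccEquiv_coeff_coeff]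
  conv_lhs => rw [h]
  rw [coeff_rename_mapDomain _ (Equiv.injective _)]

lemma md_apply (i : ℕ) (m : Fin 3 →₀ ℕ) (j : Fin 4) :
    Finsupp.mapDomain (Equiv.swap (0 : Fin 4) 3) (m.cons i) j =
      (m.cons i : Fin 4 →₀ ℕ) (Equiv.swap (0 : Fin 4) 3 j) := by
  rw [Finsupp.mapDomain_equiv_apply]; simp

lemma md_weight (i : ℕ) (m : Fin 3 →₀ ℕ) :
    Finsupp.weight (![1, 1, 2, 3] : Fin 4 → ℕ)
      (Finsupp.mapDomain (Equiv.swap (0 : Fin 4) 3) (m.cons i)) =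
      m 0 + 2 * m 1 + m 2 + 3 * i := by
  rw [wt_eq]
  simp only [md_apply]
  have e0 : Equiv.swap (0 : Fin 4) 3 0 = Fin.succ 2 := by decide
  have e1 : Equiv.swap (0 : Fin 4) 3 1 = Fin.succ 0 := by decide
  have e2 : Equiv.swap (0 : Fin 4) 3 2 = Fin.succ 1 := by decide
  have e3 : Equiv.swap (0 : Fin 4) 3 3 = 0 := by decide
  rw [e0, e1, e2, e3]
  simp only [Finsupp.cons_succ, Finsupp.cons_zero]
  ring

lemma irreducible_of_coeffs (f : MvPolynomial (Fin 4) ℂ)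
    (hf : f.IsWeightedHomogeneous ![1, 1, 2, 3] 6)
    (hc : coeff (Finsupp.single 3 2) f ≠ 0) (hd : coeff (Finsupp.single 2 3) f ≠ 0) :
    Irreducible f := by
  set c := coeff (Finsupp.single 3 2) f with hcdef
  set d := coeff (Finsupp.single 2 3) f with hddef
  have hbig : ∀ i, 2 < i → (lastEquiv f).coeff i = 0 := by
    intro i hi
    ext m
    rw [coeff_lastEquiv, coeff_zero]
    by_contra h
    have := hf h
    rw [md_weight] at this
    omega
  have h2 : (lastEquiv f).coeff 2 = C c := by
    classical
    ext m
    rw [coeff_lastEquiv, coeff_C]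
    split_ifs with h
    · rw [hcdef]
      congr 1
      subst h
      ext j
      rw [md_apply]
      fin_cases j <;> simp [Equiv.swap_apply_def, Finsupp.cons] <;> rfl
    · by_contra h0
      have := hf h0
      rw [md_weight] at this
      apply h
      ext j
      fin_cases j <;> simp <;> omega
  set P := Polynomial.C (C c⁻¹) * lastEquiv f with hP
  have hP2 : P.coeff 2 = 1 := by
    rw [hP, Polynomial.coeff_C_mul, h2, ← C_mul, inv_mul_cancel₀ hc, C_1]
  have hPle : P.natDegree ≤ 2 := by
    rw [Polynomial.natDegree_le_iff_coeff_eq_zero]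
    intro i hi
    rw [hP, Polynomial.coeff_C_mul, hbig i hi, mul_zero]
  have hPdeg : P.natDegree = 2 :=
    le_antisymm hPle (Polynomial.le_natDegree_of_ne_zero (by rw [hP2]; exact one_ne_zero))
  have hPm : P.Monic := Polynomial.monic_of_natDegree_le_of_coeff_eq_one 2 hPle hP2
  have hPirr : Irreducible P := by
    rw [hPm.irreducible_iff_roots_eq_zero_of_degree_le_three (by omega) (by omega)]
    refine Multiset.eq_zero_of_forall_notMem fun r hr => ?_
    have hr := (Polynomial.mem_roots'.1 hr).2
    rw [Polynomial.IsRoot.def, hP, Polynomial.eval_mul, Polynomial.eval_C] at hr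
    have hcc : (C c⁻¹ : MvPolynomial (Fin 3) ℂ) ≠ 0 := by simpa using hc
    have hr := (mul_eq_zero.1 hr).resolve_left hcc
    let χ : MvPolynomial (Fin 3) ℂ →ₐ[ℂ] Polynomial ℂ := aeval ![0, Polynomial.X, 0]
    have hcomp : χ.comp (((Polynomial.aeval r).restrictScalars ℂ).comp lastEquiv.toAlgHom) =
        aeval ![0, 0, Polynomial.X, χ r] := by
      have e0 : Equiv.swap (0 : Fin 4) 3 0 = Fin.succ 2 := by decide
      have e1 : Equiv.swap (0 : Fin 4) 3 1 = Fin.succ 0 := by decide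
      have e2 : Equiv.swap (0 : Fin 4) 3 2 = Fin.succ 1 := by decide
      have e3 : Equiv.swap (0 : Fin 4) 3 3 = 0 := by decide
      apply MvPolynomial.algHom_ext
      intro i
      fin_cases i
      · simp [lastEquiv, -Equiv.swap_apply_left, -Fin.reduceSucc, e0, finSuccEquiv_X_succ, χ]
      · have hx : finSuccEquiv ℂ 3 (X 1) = Polynomial.C (X 0) :=
          finSuccEquiv_X_succ (R := ℂ) (n := 3) (j := 0)
        simp [lastEquiv, e1, hx, χ]
      · have hx : finSuccEquiv ℂ 3 (X 2) = Polynomial.C (X 1) :=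
          finSuccEquiv_X_succ (R := ℂ) (n := 3) (j := 1)
        simp [lastEquiv, e2, hx, χ]
      · simp [lastEquiv, e3, finSuccEquiv_X_zero, χ]
    have h0 : aeval ![0, 0, Polynomial.X, χ r] f = 0 := by
      rw [← hcomp]
      have : χ (Polynomial.eval r (lastEquiv f)) = 0 := by rw [hr, map_zero]
      simpa [Polynomial.aeval_def, Polynomial.eval₂_eq_eval_map] using this
    rw [aeval_restrict f hf] at h0
    have h1 := congrArg Polynomial.natDegree (eq_neg_of_add_eq_zero_left h0)
    simp only [Polynomial.algebraMap_eq] at h1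
    rw [Polynomial.natDegree_neg, Polynomial.natDegree_C_mul hc, Polynomial.natDegree_C_mul hd,
      Polynomial.natDegree_pow, Polynomial.natDegree_pow, Polynomial.natDegree_X] at h1
    omega
  have hu : IsUnit (Polynomial.C (C c⁻¹ : MvPolynomial (Fin 3) ℂ)) :=
    ((isUnit_iff_ne_zero.2 (inv_ne_zero hc)).map C).map Polynomial.C
  rw [hP, irreducible_isUnit_mul hu] at hPirr
  exact (MulEquiv.irreducible_iff lastEquiv).1 hPirr

/-- Every member of the pencil generated by a smooth sextic `S = {s = 0} ⊂ ℙ(1,1,2,3)`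
and `6H`, `H = {x = 0}`, other than `6H` itself, is irreducible and reduced. -/
theorem pencil_member_irreducible_sextic
    (s : MvPolynomial (Fin 4) ℂ)
    (hs : s.IsWeightedHomogeneous ![1, 1, 2, 3] 6)
    (hsmooth : ∀ p : Fin 4 → ℂ, (∀ i : Fin 4, eval p (pderiv i s) = 0) → p = 0) :
    ∀ α : ℂ, Irreducible (s - C α * X 0 ^ 6) := by
  classical
  intro α
  obtain ⟨hc, hd⟩ := coeffs_ne s hs hsmooth
  have hx : ∀ m : Fin 4 →₀ ℕ, m 0 ≠ 6 → coeff m (C α * X 0 ^ 6 : MvPolynomial (Fin 4) ℂ) = 0 := by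
    intro m hm
    rw [coeff_C_mul, coeff_X_pow, if_neg, mul_zero]
    rintro rfl
    simp at hm
  have hxh : (C α * X 0 ^ 6 : MvPolynomial (Fin 4) ℂ).IsWeightedHomogeneous ![1, 1, 2, 3] 6 := by
    intro m hm
    rw [coeff_C_mul, coeff_X_pow] at hm
    split_ifs at hm with h
    · rw [← h, wt_eq]; simp
    · simp at hm
  refine irreducible_of_coeffs _ ?_ ?_ ?_
  · exact (weightedHomogeneousSubmodule ℂ ![1, 1, 2, 3] 6).sub_mem hs hxh
  · rw [coeff_sub, hx _ (by simp), sub_zero]; exact hc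
  · rw [coeff_sub, hx _ (by simp), sub_zero]; exact hd
end

section
/- Grade ℂ[x,y,z,w] by assigning x, y, z, w the weights 1, 1, 1, 2, and let s be weighted homogeneous of degree 4 whose four partial derivatives have the origin as their only common zero in ℂ⁴. Then for every injective ℂ-linear map ψ : ℂ² → ℂ³, the polynomial g(u₁,u₂,w) = s(ψ(u₁,u₂), w) ∈ ℂ[u₁,u₂,w] obtained by substituting (x,y,z) := ψ(u₁,u₂) into s is nonzero and squarefree. (Equivalently: for every H ∈ |𝒪_{ℙ(1,1,1,2)}(1)|, the section H|_S of the smooth quartic S = {s = 0} is a reduced anti-canonical divisor — the reducedness assertion of Proposition 1.1(2).) -/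
open MvPolynomial

/-- A weighted homogeneous quartic has the form `a w² + q₂ w + q₄`. -/
lemma quartic_decomp (s : MvPolynomial (Fin 4) ℂ)
    (hs : s.IsWeightedHomogeneous ![1, 1, 1, 2] 4) :
    ∃ (a : ℂ) (q2 q4 : MvPolynomial (Fin 3) ℂ), q2.IsHomogeneous 2 ∧ q4.IsHomogeneous 4 ∧
      s = C a * X 3 ^ 2 + rename Fin.castSucc q2 * X 3 + rename Fin.castSucc q4 := by
  rw [s.as_sum]
  refine Finset.sum_induction (fun v => monomial v (coeff v s)) (fun t => ∃ (a : ℂ)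
    (q2 q4 : MvPolynomial (Fin 3) ℂ), q2.IsHomogeneous 2 ∧ q4.IsHomogeneous 4 ∧
      t = C a * X 3 ^ 2 + rename Fin.castSucc q2 * X 3 + rename Fin.castSucc q4) ?_ ?_ ?_
  · rintro x y ⟨a, q, r, hq, hr, rfl⟩ ⟨a', q', r', hq', hr', rfl⟩
    refine ⟨a + a', q + q', r + r', hq.add hq', hr.add hr', ?_⟩
    simp only [map_add]
    ring
  · exact ⟨0, 0, 0, isHomogeneous_zero _ _ _, isHomogeneous_zero _ _ _, by simp⟩
  · intro d hd
    have h4 := hs (mem_support_iff.1 hd)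
    rw [Finsupp.weight_apply, Finsupp.sum_fintype _ _ (by simp)] at h4
    simp [Fin.sum_univ_four] at h4
    have hm : monomial d (coeff d s) =
        rename Fin.castSucc (C (coeff d s) * (X 0 ^ d 0 * X 1 ^ d 1 * X 2 ^ d 2) :
          MvPolynomial (Fin 3) ℂ) * X 3 ^ d 3 := by
      rw [monomial_eq, Finsupp.prod_fintype _ _ (by simp), Fin.prod_univ_four]
      simp only [map_mul, map_pow, rename_X, rename_C]
      simp [mul_assoc]
    have hh : (C (coeff d s) * (X 0 ^ d 0 * X 1 ^ d 1 * X 2 ^ d 2) :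
          MvPolynomial (Fin 3) ℂ).IsHomogeneous (d 0 + d 1 + d 2) :=
      (((isHomogeneous_X_pow _ _).mul (isHomogeneous_X_pow _ _)).mul
        (isHomogeneous_X_pow _ _)).C_mul _
    have : d 3 ≤ 2 := by omega
    obtain h | h | h : d 3 = 0 ∨ d 3 = 1 ∨ d 3 = 2 := by omega
    · refine ⟨0, 0, (C (coeff d s) * (X 0 ^ d 0 * X 1 ^ d 1 * X 2 ^ d 2)), isHomogeneous_zero _ _ _, ?_, ?_⟩
      rotate_left 1
      · rw [hm, h]; simp only [map_zero, zero_mul, zero_add, pow_zero, mul_one]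
      · convert hh; omega
    · refine ⟨0, (C (coeff d s) * (X 0 ^ d 0 * X 1 ^ d 1 * X 2 ^ d 2)), 0, ?_, isHomogeneous_zero _ _ _, ?_⟩
      rotate_left 1
      · rw [hm, h]; simp only [map_zero, zero_mul, zero_add, pow_one, add_zero]
      · convert hh; omega
    · refine ⟨coeff d s, 0, 0, isHomogeneous_zero _ _ _, isHomogeneous_zero _ _ _, ?_⟩
      have h0 : d 0 = 0 := by omega
      have h1 : d 1 = 0 := by omega
      have h2 : d 2 = 0 := by omega
      rw [hm, h, h0, h1, h2]
      simp

lemma hom_eval_smul {σ : Type*} {n : ℕ} (F : MvPolynomial σ ℂ) (hF : F.IsHomogeneous n)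
    (t : ℂ) (u : σ → ℂ) : eval (fun i => t * u i) F = t ^ n * eval u F := by
  rw [eval_eq, eval_eq, Finset.mul_sum]
  refine Finset.sum_congr rfl fun d hd => ?_
  have h := hF (mem_support_iff.1 hd)
  have h' : ∑ i ∈ d.support, d i = n := by
    rw [← h, Finsupp.weight_apply]
    simp [Finsupp.sum]
  simp only [mul_pow, Finset.prod_mul_distrib, Finset.prod_pow_eq_pow_sum, h']
  ring

/-- A binary form of positive degree over `ℂ` has a nontrivial zero. -/
lemma cubic_root (F : MvPolynomial (Fin 2) ℂ) (hF : F.IsHomogeneous 3) :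
    ∃ u : Fin 2 → ℂ, u ≠ 0 ∧ eval u F = 0 := by
  by_contra! hcon
  have key : ∀ v : Fin 2 → Polynomial ℂ, (∀ t, (fun i => (v i).eval t) ≠ 0) →
      ∃ c, ∀ t, eval (fun i => (v i).eval t) F = c := by
    intro v hv
    have hev : ∀ t, (aeval v F).eval t = eval (fun i => (v i).eval t) F := by
      intro t
      have := MvPolynomial.map_aeval v (Polynomial.evalRingHom t) F
      simp only [Polynomial.coe_evalRingHom] at this
      rw [this]
      congr 2
      ext; simp
    by_cases hd : (aeval v F).degree = 0
    · rw [Polynomial.eq_C_of_degree_eq_zero hd] at hev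
      exact ⟨_, fun t => by rw [← hev t, Polynomial.eval_C]⟩
    · obtain ⟨t, ht⟩ := IsAlgClosed.exists_root _ hd
      exact absurd (by rw [← hev]; exact ht) (hcon _ (hv t))
  obtain ⟨c, hc⟩ := key ![Polynomial.X, 1] (fun t h => by simpa using congrFun h 1)
  obtain ⟨e, he⟩ := key ![1, Polynomial.X] (fun t h => by simpa using congrFun h 0)
  have h1 := hom_eval_smul F hF 2 (fun i => ((![1, Polynomial.X] : Fin 2 → Polynomial ℂ) i).eval (1/2))
  have e1 : (fun i => 2 * ((![1, Polynomial.X] : Fin 2 → Polynomial ℂ) i).eval (1/2)) =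
     (fun i => ((![Polynomial.X, 1] : Fin 2 → Polynomial ℂ) i).eval 2) := by
    ext i; fin_cases i <;> simp
  have e2 : (fun i => ((![1, Polynomial.X] : Fin 2 → Polynomial ℂ) i).eval 1) =
     (fun i => ((![Polynomial.X, 1] : Fin 2 → Polynomial ℂ) i).eval 1) := by
    ext i; fin_cases i <;> simp
  rw [e1, hc, he] at h1
  have h2 := he 1
  rw [e2, hc] at h2
  rw [h2] at h1
  have h0 : e = 0 := by linear_combination (-1/7) * h1
  refine hcon (fun i => ((![1, Polynomial.X] : Fin 2 → Polynomial ℂ) i).eval 1)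
    (fun h => by simpa using congrFun h 0) ?_
  rw [he, h0]

lemma chain_rule (L : Fin 3 → MvPolynomial (Fin 2) ℂ) (i : Fin 2) (D : MvPolynomial (Fin 3) ℂ) :
    pderiv i (aeval L D) = ∑ j, aeval L (pderiv j D) * pderiv i (L j) := by
  induction D using MvPolynomial.induction_on with
  | C a => simp [pderiv_C]
  | add p q hp hq => simp only [map_add, hp, hq, add_mul, Finset.sum_add_distrib]
  | mul_X p k hp =>
    simp only [map_mul, pderiv_mul, hp, aeval_X, map_add, add_mul, Finset.sum_add_distrib,
      pderiv_X]
    congr 1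
    · rw [Finset.sum_mul]; exact Finset.sum_congr rfl fun _ _ => by ring
    · rw [Finset.sum_eq_single k]
      · simp
      · intro b _ hb; simp [Pi.single_apply, hb.symm]
      · simp

lemma singular_point (ψ : (Fin 2 → ℂ) →ₗ[ℂ] (Fin 3 → ℂ)) (hψ : Function.Injective ψ)
    (D : MvPolynomial (Fin 3) ℂ) (hD : D.IsHomogeneous 4)
    (L : Fin 3 → MvPolynomial (Fin 2) ℂ)
    (hL : ∀ j, L j = ∑ i : Fin 2, C (ψ (Pi.single i 1) j) * X i)
    (h0 : aeval L D = 0) : ∃ p : Fin 3 → ℂ, p ≠ 0 ∧ (∃ u, p = fun j => eval u (L j)) ∧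
      ∀ j, eval p (pderiv j D) = 0 := by
  have hfr : Module.finrank ℂ (LinearMap.range ψ) = 2 := by
    rw [LinearMap.finrank_range_of_inj hψ]; simp
  have hne : LinearMap.range ψ ≠ ⊤ := by
    intro h; rw [h, finrank_top] at hfr; simp at hfr
  obtain ⟨v, hv⟩ : ∃ v, v ∉ LinearMap.range ψ := by
    by_contra! h; exact hne (eq_top_iff.2 fun x _ => h x)
  have hLe : ∀ u : Fin 2 → ℂ, (fun j => eval u (L j)) = ψ u := by
    intro u
    ext j
    conv_rhs => rw [LinearMap.pi_apply_eq_sum_univ ψ u]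
    simp [hL, mul_comm]
    congr! <;> simp [Pi.single_apply, eq_comm]
  obtain ⟨u, hu, hE⟩ := cubic_root (∑ j, C (v j) * aeval L (pderiv j D)) (by
    refine IsHomogeneous.sum _ _ _ fun j _ => IsHomogeneous.C_mul ?_ _
    have h3 : (pderiv j D).IsHomogeneous 3 := hD.pderiv
    have := h3.aeval L (n := 1) (fun k => by
      rw [hL]; exact IsHomogeneous.sum _ _ _ fun j _ => isHomogeneous_C_mul_X _ _)
    simpa using this)
  have hcomp : ∀ Q : MvPolynomial (Fin 3) ℂ, eval u (aeval L Q) = eval (ψ u) Q := by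
    intro Q
    rw [← hLe]
    have := MvPolynomial.map_aeval L (eval u) Q
    rw [this]
    congr 2
    ext; simp
  refine ⟨ψ u, fun h => hu (hψ (by simpa using h)), ⟨u, (hLe u).symm⟩, ?_⟩
  -- the gradient functional
  let φ : (Fin 3 → ℂ) →ₗ[ℂ] ℂ :=
    ∑ j, (eval (ψ u) (pderiv j D)) • LinearMap.proj j
  have hφ : ∀ x, φ x = ∑ j, eval (ψ u) (pderiv j D) * x j := by
    intro x; simp [φ]
  have hv0 : φ v = 0 := by
    rw [hφ]; simp only [map_sum, map_mul, eval_C, hcomp] at hE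
    rw [← hE]; exact Finset.sum_congr rfl fun _ _ => mul_comm _ _
  have hr0 : φ ∘ₗ ψ = 0 := by
    refine LinearMap.pi_ext' fun i => LinearMap.ext_ring ?_
    have hc := congrArg (eval u) (chain_rule L i D)
    rw [h0] at hc
    simp only [map_sum, map_mul, hcomp, map_zero] at hc
    simp only [LinearMap.comp_apply, hφ, LinearMap.single_apply]
    rw [LinearMap.zero_apply, hc]
    refine Finset.sum_congr rfl fun j _ => ?_
    congr 1
    simp only [hL, map_sum, pderiv_C_mul, pderiv_X, map_mul, eval_C]
    rw [Finset.sum_eq_single i]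
    · simp
    · intro b _ hb; simp [Pi.single_apply, hb]
    · simp
  have hlt : LinearMap.range ψ < LinearMap.ker φ := by
    refine lt_of_le_of_ne (LinearMap.range_le_ker_iff.2 hr0) fun h => hv ?_
    rw [h]; exact hv0
  have hker : LinearMap.ker φ = ⊤ := by
    apply Submodule.eq_top_of_finrank_eq
    have h1 := Submodule.finrank_lt_finrank_of_lt hlt
    have h2 := Submodule.finrank_le (LinearMap.ker φ)
    simp at h2 ⊢
    omega
  intro j
  have : φ (Pi.single j 1) = 0 := by
    rw [LinearMap.ker_eq_top.1 hker]; rfl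
  rw [hφ] at this
  simpa [Pi.single_apply] using this

lemma disc_zero {R : Type*} [CommRing R] [IsDomain R] (a q r : R) (ha : IsUnit a)
    (F : Polynomial R) (hF : F * F ∣ Polynomial.C a * Polynomial.X ^ 2 + Polynomial.C q * Polynomial.X
      + Polynomial.C r) (hu : ¬ IsUnit F) : 4 * a * r - q ^ 2 = 0 := by
  obtain ⟨H, hH⟩ := hF
  have ha0 := ha.ne_zero
  have hdeg := Polynomial.natDegree_quadratic (b := q) (c := r) ha0
  have hlc := Polynomial.leadingCoeff_quadratic (b := q) (c := r) ha0
  rw [hH] at hdeg hlc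
  have hne : F * F * H ≠ 0 := by
    intro h; rw [h] at hdeg; simp at hdeg
  have hF0 : F ≠ 0 := by rintro rfl; simp at hne
  have hH0 : H ≠ 0 := by rintro rfl; simp at hne
  rw [Polynomial.natDegree_mul (mul_ne_zero hF0 hF0) hH0, Polynomial.natDegree_mul hF0 hF0] at hdeg
  rw [Polynomial.leadingCoeff_mul, Polynomial.leadingCoeff_mul] at hlc
  have hFd : F.natDegree ≠ 0 := by
    intro h
    apply hu
    rw [Polynomial.eq_C_of_natDegree_eq_zero h]
    apply Polynomial.isUnit_C.2
    have : F.leadingCoeff = F.coeff 0 := by rw [Polynomial.leadingCoeff, h]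
    rw [← this]
    rw [← hlc, mul_assoc] at ha
    exact isUnit_of_mul_isUnit_left ha
  have hH1 : H.natDegree = 0 := by omega
  have hF1 : F.natDegree ≤ 1 := by omega
  obtain ⟨α, β, rfl⟩ := Polynomial.exists_eq_X_add_C_of_natDegree_le_one hF1
  rw [Polynomial.eq_C_of_natDegree_eq_zero hH1] at hH
  set γ := H.coeff 0
  have hH' : Polynomial.C a * Polynomial.X ^ 2 + Polynomial.C q * Polynomial.X + Polynomial.C r
     = Polynomial.C (α^2*γ) * Polynomial.X ^ 2 + Polynomial.C (2*α*β*γ) * Polynomial.X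
       + Polynomial.C (β^2*γ) := by
    rw [hH]; simp only [map_mul, map_pow, map_ofNat]; ring
  have c0 := congrArg (fun p => Polynomial.coeff p 0) hH'
  have c1 := congrArg (fun p => Polynomial.coeff p 1) hH'
  have c2 := congrArg (fun p => Polynomial.coeff p 2) hH'
  simp [Polynomial.coeff_X, Polynomial.coeff_C, -map_mul, -map_pow] at c0 c1 c2
  rw [c0, c1, c2]; ring

theorem hyperplane_section_of_smooth_quartic_reduced
    (s : MvPolynomial (Fin 4) ℂ)
    (hs : s.IsWeightedHomogeneous ![1, 1, 1, 2] 4)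
    (hsmooth : ∀ p : Fin 4 → ℂ, (∀ i : Fin 4, eval p (pderiv i s) = 0) → p = 0)
    (ψ : (Fin 2 → ℂ) →ₗ[ℂ] (Fin 3 → ℂ)) (hψ : Function.Injective ψ)
    (g : MvPolynomial (Fin 3) ℂ)
    (hg : g = aeval (fun j : Fin 4 =>
      if h : (j : ℕ) < 3 then
        ∑ i : Fin 2, C (ψ (Pi.single i 1) ⟨(j : ℕ), h⟩) * X (Fin.castSucc i)
      else X 2) s) :
    g ≠ 0 ∧ Squarefree g := by
  obtain ⟨a, q2, q4, h2, h4, hsd⟩ := quartic_decomp s hs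
  have hd3 : ∀ Q : MvPolynomial (Fin 3) ℂ, pderiv (3 : Fin 4) (rename Fin.castSucc Q) = 0 := by
    intro Q
    classical
    apply pderiv_eq_zero_of_notMem_vars
    intro h
    obtain ⟨j, _, hj⟩ := mem_vars_rename _ _ h
    exact absurd hj (Fin.castSucc_lt_last j).ne
  -- the partial derivatives of `s`
  have hp3 : ∀ p, eval p (pderiv 3 s) = 2 * a * p 3 + eval (p ∘ Fin.castSucc) q2 := by
    intro p
    rw [hsd]
    simp [hd3, pderiv_mul, pderiv_pow, pderiv_C, eval_rename]
    ring
  have hpj : ∀ p (j : Fin 3), eval p (pderiv j.castSucc s) =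
      eval (p ∘ Fin.castSucc) (pderiv j q2) * p 3 + eval (p ∘ Fin.castSucc) (pderiv j q4) := by
    intro p j
    have : (3 : Fin 4) ≠ j.castSucc := (Fin.castSucc_lt_last j).ne'
    rw [hsd]
    simp [pderiv_mul, pderiv_pow, pderiv_C, pderiv_rename (Fin.castSucc_injective 3), eval_rename,
      pderiv_X_of_ne this]
    ring
  have hz : ∀ {n : ℕ} (Q : MvPolynomial (Fin 3) ℂ), Q.IsHomogeneous (n + 1) → eval 0 Q = 0 := by
    intro n Q hQ
    have := hom_eval_smul Q hQ 0 0
    simpa [← Pi.zero_def] using this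
  have ha : a ≠ 0 := by
    rintro rfl
    have := hsmooth (Fin.snoc (0 : Fin 3 → ℂ) (1 : ℂ) : Fin 4 → ℂ) (by
      have e : (Fin.snoc (0 : Fin 3 → ℂ) (1 : ℂ) : Fin 4 → ℂ) ∘ Fin.castSucc = 0 := by
        ext j; simp
      intro i
      induction i using Fin.lastCases with
      | last =>
        refine (hp3 _).trans ?_
        rw [e, hz (n := 1) q2 h2]; simp
      | cast j =>
        rw [hpj, e, hz (n := 0) _ h2.pderiv, hz (n := 2) _ h4.pderiv]; simp)
    have h := congrFun this (Fin.last 3)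
    rw [Fin.snoc_last] at h
    exact one_ne_zero h
  -- the substituted polynomial, viewed as a polynomial in `w`
  let L : Fin 3 → MvPolynomial (Fin 2) ℂ := fun j => ∑ i : Fin 2, C (ψ (Pi.single i 1) j) * X i
  let Φ : MvPolynomial (Fin 3) ℂ ≃ₐ[ℂ] Polynomial (MvPolynomial (Fin 2) ℂ) :=
    (renameEquiv ℂ (finRotate 3)).trans (finSuccEquiv ℂ 2)
  have hΦ2 : Φ (X 2) = Polynomial.X := by
    have : finRotate 3 2 = 0 := by decide
    simp [Φ, this, finSuccEquiv_X_zero]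
  have hΦi : ∀ i : Fin 2, Φ (X i.castSucc) = Polynomial.C (X i) := by
    intro i
    have : finRotate 3 i.castSucc = i.succ := by revert i; decide
    simp only [Φ, AlgEquiv.trans_apply, renameEquiv_apply, rename_X, this, finSuccEquiv_X_succ]
  have hΦC : ∀ c : ℂ, Φ (C c) = Polynomial.C (C c) := fun c => Φ.commutes c
  have hΦg : Φ g = Polynomial.C (C a) * Polynomial.X ^ 2 + Polynomial.C (aeval L q2) * Polynomial.X
      + Polynomial.C (aeval L q4) := by
    have hθ : ∀ Q : MvPolynomial (Fin 3) ℂ, Φ (aeval (fun j : Fin 4 =>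
      if h : (j : ℕ) < 3 then
        ∑ i : Fin 2, C (ψ (Pi.single i 1) ⟨(j : ℕ), h⟩) * X (Fin.castSucc i)
      else (X 2 : MvPolynomial (Fin 3) ℂ)) (rename Fin.castSucc Q)) =
        Polynomial.C (aeval L Q) := by
      intro Q
      rw [aeval_rename, ← Polynomial.algebraMap_eq, ← aeval_algebraMap_apply]
      rw [← AlgEquiv.coe_toAlgHom, ← AlgHom.comp_apply, comp_aeval]
      congr 2
      funext j
      simp [L, hΦC, -Fin.sum_univ_two, hΦi]
    rw [hg, hsd]
    simp only [map_add, map_mul, map_pow, hθ, aeval_X, aeval_C]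
    simp [hΦ2]
    exact hΦC a
  have hg0 : g ≠ 0 := by
    rintro rfl
    have := congrArg (fun p => Polynomial.coeff p 2) hΦg
    simp [Polynomial.coeff_X, Polynomial.coeff_C] at this
    exact ha (C_eq_zero.1 this.symm)
  refine ⟨hg0, fun f hf => ?_⟩
  by_contra hu
  have hdisc := disc_zero (C a) (aeval L q2) (aeval L q4) ((isUnit_iff_ne_zero.2 ha).map C) (Φ f)
    (by rw [← hΦg, ← map_mul]; exact map_dvd Φ hf)
    (fun h => hu ((MulEquiv.isUnit_map Φ).1 h))
  obtain ⟨p, hp0, -, hp⟩ := singular_point ψ hψ (C (4 * a) * q4 - q2 ^ 2)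
    ((h4.C_mul _).sub (h2.pow 2)) L (fun _ => rfl) (by
      simp only [map_sub, map_mul, map_pow, aeval_C]
      rw [← hdisc]
      simp only [algebraMap_eq, map_mul, map_ofNat])
  have := hsmooth (Fin.snoc p (-(eval p q2) / (2 * a)) : Fin 4 → ℂ) (by
      have e : (Fin.snoc p (-(eval p q2) / (2 * a)) : Fin 4 → ℂ) ∘ Fin.castSucc = p := by
        ext j; simp
      have e3 : (Fin.snoc p (-(eval p q2) / (2 * a)) : Fin 4 → ℂ) 3 = -(eval p q2) / (2 * a) :=
        Fin.snoc_last (α := fun _ => ℂ) _ _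
      intro i
      induction i using Fin.lastCases with
      | last =>
        refine (hp3 _).trans ?_
        rw [e, e3]; field_simp; ring
      | cast j =>
        rw [hpj, e, e3]
        have := hp j
        simp [pderiv_mul, pderiv_pow, pderiv_C] at this
        field_simp
        linear_combination this / 2)
  apply hp0
  ext j
  simpa using congrFun this j.castSucc
end

section
/- Grade ℂ[x,y,z,w] by assigning x, y, z, w the weights 1, 1, 2, 3, and let s be weighted homogeneous of degree 6 whose four partial derivatives have the origin as their only common zero in ℂ⁴. Then for every pair (a,b) ∈ ℂ² with (a,b) ≠ (0,0), the polynomial g(u,z,w) = s(b·u, −a·u, z, w) ∈ ℂ[u,z,w] is irreducible. (Equivalently: for every H = {a·x + b·y = 0} ∈ |𝒪_{ℙ(1,1,2,3)}(1)|, the section H|_S of the smooth sextic S = {s = 0} is an irreducible and reduced anti-canonical divisor — Proposition 1.1(3).) -/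
open MvPolynomial

namespace SexticAux

lemma weight_eq {s : MvPolynomial (Fin 4) ℂ}
    (hs : s.IsWeightedHomogeneous ![1, 1, 2, 3] 6) {m : Fin 4 →₀ ℕ} (hm : coeff m s ≠ 0) :
    m 0 + m 1 + 2 * m 2 + 3 * m 3 = 6 := by
  have h := hs hm
  rw [Finsupp.weight_apply, Finsupp.sum_fintype _ _ (by simp)] at h
  simp [Fin.sum_univ_four] at h
  omega

lemma finsupp_ext4 {m : Fin 4 →₀ ℕ} {n : Fin 4 →₀ ℕ} (h0 : m 0 = n 0) (h1 : m 1 = n 1)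
    (h2 : m 2 = n 2) (h3 : m 3 = n 3) : m = n := by
  ext i
  fin_cases i <;> assumption

lemma eval_pderiv (s : MvPolynomial (Fin 4) ℂ) (p : Fin 4 → ℂ) (i : Fin 4) :
    eval p (pderiv i s) = ∑ m ∈ s.support,
      coeff m s * m i * ∏ j, p j ^ ((m - Finsupp.single i 1 : Fin 4 →₀ ℕ) j) := by
  conv_lhs => rw [s.as_sum]
  simp only [map_sum, pderiv_monomial, eval_monomial]
  refine Finset.sum_congr rfl fun m _ => ?_
  rw [Finsupp.prod_fintype _ _ (by simp)]

lemma alpha_ne {s : MvPolynomial (Fin 4) ℂ}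
    (hs : s.IsWeightedHomogeneous ![1, 1, 2, 3] 6)
    (hsmooth : ∀ p : Fin 4 → ℂ, (∀ i : Fin 4, eval p (pderiv i s) = 0) → p = 0) :
    coeff (Finsupp.single 3 2) s ≠ 0 := by
  intro h0
  have := hsmooth ![0, 0, 0, 1] (fun i => by
    rw [eval_pderiv]
    refine Finset.sum_eq_zero fun m hm => ?_
    have hm' := mem_support_iff.1 hm
    have hw := weight_eq hs hm'
    have hne : ¬ (m 0 = 0 ∧ m 1 = 0 ∧ m 2 = 0) := by
      rintro ⟨h1, h2, h3⟩
      apply hm'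
      rw [← h0]
      congr 1
      apply finsupp_ext4 <;> simp [*] ; omega
    fin_cases i <;> simp [Fin.prod_univ_four, Finsupp.single_apply, hm'] <;> omega)
  simpa using congrFun this 3

lemma beta_ne {s : MvPolynomial (Fin 4) ℂ}
    (hs : s.IsWeightedHomogeneous ![1, 1, 2, 3] 6)
    (hsmooth : ∀ p : Fin 4 → ℂ, (∀ i : Fin 4, eval p (pderiv i s) = 0) → p = 0) :
    coeff (Finsupp.single 2 3) s ≠ 0 := by
  intro h0
  have := hsmooth ![0, 0, 1, 0] (fun i => by
    rw [eval_pderiv]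
    refine Finset.sum_eq_zero fun m hm => ?_
    have hm' := mem_support_iff.1 hm
    have hw := weight_eq hs hm'
    have hne : ¬ (m 0 = 0 ∧ m 1 = 0 ∧ m 3 = 0) := by
      rintro ⟨h1, h2, h3⟩
      apply hm'
      rw [← h0]
      congr 1
      apply finsupp_ext4 <;> simp [*] ; omega
    fin_cases i <;> simp [Fin.prod_univ_four, Finsupp.single_apply, hm'] <;> omega)
  simpa using congrFun this 2

/-- View a polynomial in `u, z, w` as a polynomial in `w` over `ℂ[z, u]`. -/
noncomputable def e : MvPolynomial (Fin 3) ℂ ≃ₐ[ℂ] Polynomial (MvPolynomial (Fin 2) ℂ) :=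
  (renameEquiv ℂ (Equiv.swap (0 : Fin 3) 2)).trans (finSuccEquiv ℂ 2)

lemma e_X0 : e (X 0) = Polynomial.C (X 1) := by
  simp only [e, AlgEquiv.trans_apply, renameEquiv_apply, rename_X, Equiv.swap_apply_left]
  exact finSuccEquiv_X_succ (j := (1 : Fin 2))

lemma e_X1 : e (X 1) = Polynomial.C (X 0) := by
  simp only [e, AlgEquiv.trans_apply, renameEquiv_apply, rename_X]
  rw [Equiv.swap_apply_of_ne_of_ne (by decide) (by decide)]
  exact finSuccEquiv_X_succ (j := (0 : Fin 2))

lemma e_X2 : e (X 2) = Polynomial.X := by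
  simp only [e, AlgEquiv.trans_apply, renameEquiv_apply, rename_X, Equiv.swap_apply_right]
  exact finSuccEquiv_X_zero

lemma e_C (c : ℂ) : e (C c) = Polynomial.C (C c) := by
  rw [← algebraMap_eq, AlgEquiv.commutes]; rfl

/-- Restriction to `u = 0`. -/
noncomputable def φ : MvPolynomial (Fin 2) ℂ →ₐ[ℂ] Polynomial ℂ := aeval ![Polynomial.X, 0]

lemma form_monomial (a b c : ℂ) (m : Fin 4 →₀ ℕ) (hm : m 0 + m 1 + 2 * m 2 + 3 * m 3 = 6) :
    ∃ c1 c0 : MvPolynomial (Fin 2) ℂ,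
      e (aeval ![C b * X 0, C (-a) * X 0, X 1, X 2] (monomial m c)) =
        Polynomial.C (C (coeff (Finsupp.single 3 2) (monomial m c))) * Polynomial.X ^ 2
          + Polynomial.C c1 * Polynomial.X + Polynomial.C c0 ∧ φ c1 = 0 ∧
        φ c0 = Polynomial.C (coeff (Finsupp.single 2 3) (monomial m c)) * Polynomial.X ^ 3 := by
  set d : MvPolynomial (Fin 2) ℂ :=
    C c * ((C b * X 1) ^ m 0 * (C (-a) * X 1) ^ m 1 * X 0 ^ m 2) with hd
  have key : e (aeval ![C b * X 0, C (-a) * X 0, X 1, X 2] (monomial m c)) =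
      Polynomial.C d * Polynomial.X ^ m 3 := by
    rw [aeval_monomial, Finsupp.prod_fintype _ _ (by simp), Fin.prod_univ_four, algebraMap_eq]
    simp only [map_mul, map_pow, e_C, hd, Matrix.cons_val, e_X0, e_X1, e_X2]
    ring
  have hφ : φ d = Polynomial.C c * ((Polynomial.C b * 0) ^ m 0 * (Polynomial.C (-a) * 0) ^ m 1
      * Polynomial.X ^ m 2) := by
    simp [hd, φ, algHom_C]
  have hφ0 : ¬ (m 0 = 0 ∧ m 1 = 0) → φ d = 0 := by
    intro h
    rw [hφ]
    by_cases h0 : m 0 = 0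
    · have h1 : m 1 ≠ 0 := fun h1 => h ⟨h0, h1⟩
      simp [h1]
    · simp [h0]
  rw [key]
  have h3 : m 3 = 0 ∨ m 3 = 1 ∨ m 3 = 2 := by omega
  rcases h3 with h3 | h3 | h3
  · have hA : m ≠ Finsupp.single 3 2 := by rintro rfl; simp at h3
    refine ⟨0, d, by simp [coeff_monomial, hA, h3], by simp, ?_⟩
    by_cases hB : m = Finsupp.single 2 3
    · rw [hφ, hB]; simp
    · rw [coeff_monomial, if_neg hB, hφ0]
      · simp
      · rintro ⟨h0, h1⟩
        exact hB (by apply finsupp_ext4 <;> simp [*] ; omega)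
  · have hA : m ≠ Finsupp.single 3 2 := by rintro rfl; simp at h3
    have hB : m ≠ Finsupp.single 2 3 := by rintro rfl; simp at h3
    refine ⟨d, 0, by simp [coeff_monomial, hA, h3], hφ0 (by omega), ?_⟩
    simp [coeff_monomial, hB]
  · have hA : m = Finsupp.single 3 2 := by
      apply finsupp_ext4 <;> simp [h3] <;> omega
    have hB : m ≠ Finsupp.single 2 3 := by rintro rfl; simp at h3
    refine ⟨0, 0, ?_, by simp, by simp [coeff_monomial, hB]⟩
    simp [hd, hA]

lemma form (a b : ℂ) {s : MvPolynomial (Fin 4) ℂ}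
    (hs : s.IsWeightedHomogeneous ![1, 1, 2, 3] 6) :
    ∃ c1 c0 : MvPolynomial (Fin 2) ℂ,
      e (aeval ![C b * X 0, C (-a) * X 0, X 1, X 2] s) =
        Polynomial.C (C (coeff (Finsupp.single 3 2) s)) * Polynomial.X ^ 2
          + Polynomial.C c1 * Polynomial.X + Polynomial.C c0 ∧ φ c1 = 0 ∧
        φ c0 = Polynomial.C (coeff (Finsupp.single 2 3) s) * Polynomial.X ^ 3 := by
  have h : ∀ m ∈ s.support, m 0 + m 1 + 2 * m 2 + 3 * m 3 = 6 :=
    fun m hm => weight_eq hs (mem_support_iff.1 hm)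
  rw [s.as_sum]
  generalize s.support = T at h
  generalize (fun v => coeff v s) = f
  induction T using Finset.induction_on with
  | empty => exact ⟨0, 0, by simp, by simp, by simp⟩
  | insert m T hmT ih =>
    obtain ⟨c1, c0, h1, h2, h3⟩ := ih fun n hn => h n (Finset.mem_insert_of_mem hn)
    obtain ⟨d1, d0, g1, g2, g3⟩ :=
      form_monomial a b (coeff m s) m (h m (Finset.mem_insert_self _ _))
    refine ⟨d1 + c1, d0 + c0, ?_, by rw [map_add, g2, h2, add_zero], ?_⟩
    · rw [Finset.sum_insert hmT, map_add, map_add, h1, g1, coeff_add]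
      simp only [map_add]
      ring
    · rw [Finset.sum_insert hmT, map_add, h3, g3, coeff_add]
      simp only [map_add]
      ring

lemma irr_base (γ : ℂ) (hγ : γ ≠ 0) :
    Irreducible (Polynomial.X ^ 2 + Polynomial.C (Polynomial.C γ * Polynomial.X ^ 3) :
      Polynomial (Polynomial ℂ)) := by
  have hdeg := Polynomial.natDegree_X_pow_add_C (n := 2)
    (r := (Polynomial.C γ * Polynomial.X ^ 3 : Polynomial ℂ))
  rw [Polynomial.Monic.irreducible_iff_roots_eq_zero_of_degree_le_three
    (Polynomial.monic_X_pow_add_C _ two_ne_zero) hdeg.ge (by omega)]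
  rw [Multiset.eq_zero_iff_forall_notMem]
  intro r hr
  have h := Polynomial.isRoot_of_mem_roots hr
  simp only [Polynomial.IsRoot.def, Polynomial.eval_add, Polynomial.eval_pow, Polynomial.eval_X,
    Polynomial.eval_C] at h
  have h2 := congrArg Polynomial.natDegree (eq_neg_of_add_eq_zero_left h)
  rw [Polynomial.natDegree_pow, Polynomial.natDegree_neg, Polynomial.natDegree_C_mul_X_pow _ _ hγ]
    at h2
  omega

end SexticAux

open SexticAux in
/-- For every `H = {a·x + b·y = 0} ∈ |𝒪_{ℙ(1,1,2,3)}(1)|`, the section `H|_S` of a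
smooth sextic `S = {s = 0} ⊂ ℙ(1,1,2,3)` is irreducible and reduced: substituting
`(x, y) := (b·u, −a·u)` into `s` yields an irreducible polynomial in `u, z, w`. -/
theorem hyperplane_section_of_smooth_sextic_irreducible
    (s : MvPolynomial (Fin 4) ℂ)
    (hs : s.IsWeightedHomogeneous ![1, 1, 2, 3] 6)
    (hsmooth : ∀ p : Fin 4 → ℂ, (∀ i : Fin 4, eval p (pderiv i s) = 0) → p = 0)
    (a b : ℂ) (hab : (a, b) ≠ (0, 0)) :
    Irreducible (aeval ![C b * X 0, C (-a) * X 0, X 1, X 2] s :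
      MvPolynomial (Fin 3) ℂ) := by
  have hα := alpha_ne hs hsmooth
  have hβ := beta_ne hs hsmooth
  obtain ⟨c1, c0, h1, h2, h3⟩ := form a b hs
  rw [← MulEquiv.irreducible_iff e, h1]
  generalize coeff (Finsupp.single 3 2) s = α at *
  generalize coeff (Finsupp.single 2 3) s = β at *
  have hu : IsUnit (Polynomial.C (C α⁻¹) : Polynomial (MvPolynomial (Fin 2) ℂ)) :=
    ((isUnit_iff_ne_zero.2 (inv_ne_zero hα)).map C).map Polynomial.C
  have hαα : (C α⁻¹ * C α : MvPolynomial (Fin 2) ℂ) = 1 := by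
    rw [← C_mul, inv_mul_cancel₀ hα, C_1]
  rw [← irreducible_isUnit_mul hu]
  have hform : Polynomial.C (C α⁻¹) * (Polynomial.C (C α) * Polynomial.X ^ 2
      + Polynomial.C c1 * Polynomial.X + Polynomial.C c0) =
      Polynomial.X ^ 2 + (Polynomial.C (C α⁻¹ * c1) * Polynomial.X
        + Polynomial.C (C α⁻¹ * c0)) := by
    rw [mul_add, mul_add, ← mul_assoc, ← Polynomial.C_mul, hαα]
    simp only [Polynomial.C_mul, Polynomial.C_1]
    ring
  rw [hform]
  refine Polynomial.Monic.irreducible_of_irreducible_map φ.toRingHom _ ?_ ?_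
  · exact Polynomial.monic_X_pow_add (lt_of_le_of_lt Polynomial.degree_linear_le (by norm_num))
  · have := irr_base (α⁻¹ * β) (mul_ne_zero (inv_ne_zero hα) hβ)
    convert this using 1
    have hC : φ (C α⁻¹) = Polynomial.C α⁻¹ := by simp [φ]
    simp [h2, h3, hC, mul_assoc]
end

section
/- Let s ∈ ℂ[x₀,x₁,x₂,x₃] be a homogeneous polynomial of degree 3 such that the only common zero in ℂ⁴ of its four partial derivatives is the origin, and let l, l' : ℂ⁴ → ℂ be linear forms with l ≠ 0. If every point p ∈ ℂ⁴ with s(p) = 0 and l(p) = 0 also satisfies l'(p) = 0, then l' = c·l for some c ∈ ℂ. (A hyperplane of ℙ³ is determined by its intersection with a smooth cubic surface: if H' ∩ S ⊆ H ∩ S for hyperplanes H, H', then H' = H — the key step in the proof of Lemma 1.3 for degree 3.) -/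
open MvPolynomial

/-- Restriction of a polynomial to the parametrized line `p + X d`. -/
noncomputable def lineRes (p d : Fin 4 → ℂ) (f : MvPolynomial (Fin 4) ℂ) : Polynomial ℂ :=
  aeval (fun i => Polynomial.C (p i) + Polynomial.C (d i) * Polynomial.X) f

lemma lineRes_eval (p d : Fin 4 → ℂ) (f : MvPolynomial (Fin 4) ℂ) (z : ℂ) :
    (lineRes p d f).eval z = eval (p + z • d) f := by
  unfold lineRes
  induction f using MvPolynomial.induction_on with
  | C a => simp
  | add f g hf hg => simp [hf, hg]
  | mul_X f i hf =>
    simp [hf]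
    left; ring

lemma lineRes_add (p d : Fin 4 → ℂ) (f g : MvPolynomial (Fin 4) ℂ) :
    lineRes p d (f + g) = lineRes p d f + lineRes p d g := map_add _ _ _

lemma lineRes_mul (p d : Fin 4 → ℂ) (f g : MvPolynomial (Fin 4) ℂ) :
    lineRes p d (f * g) = lineRes p d f * lineRes p d g := map_mul _ _ _

lemma lineRes_X (p d : Fin 4 → ℂ) (j : Fin 4) :
    lineRes p d (X j) = Polynomial.C (p j) + Polynomial.C (d j) * Polynomial.X := by
  simp [lineRes]

lemma lineRes_derivative (p d : Fin 4 → ℂ) (f : MvPolynomial (Fin 4) ℂ) :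
    (lineRes p d f).derivative = ∑ i, Polynomial.C (d i) * lineRes p d (pderiv i f) := by
  induction f using MvPolynomial.induction_on with
  | C a => simp [lineRes]
  | add f g hf hg => simp [lineRes_add, hf, hg, mul_add, Finset.sum_add_distrib]
  | mul_X f j hf =>
    have h1 : ∑ i, Polynomial.C (d i) * lineRes p d (f * pderiv i (X j))
        = lineRes p d f * Polynomial.C (d j) := by
      rw [Finset.sum_eq_single j]
      · simp [mul_comm]
      · intro i _ hij
        rw [pderiv_X_of_ne hij.symm]
        simp [lineRes]
      · simp
    have h2 : (lineRes p d (X j)).derivative = Polynomial.C (d j) := by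
      simp [lineRes_X]
    have h3 : ∑ i, Polynomial.C (d i) * lineRes p d (X j * pderiv i f)
        = (∑ i, Polynomial.C (d i) * lineRes p d (pderiv i f)) * lineRes p d (X j) := by
      rw [Finset.sum_mul]
      exact Finset.sum_congr rfl fun i _ => by rw [lineRes_mul]; ring
    simp only [Derivation.leibniz, smul_eq_mul, lineRes_add, mul_add, Finset.sum_add_distrib]
    rw [h1, h3, lineRes_mul, Polynomial.derivative_mul, hf, h2, add_comm]

lemma lineRes_deriv_zero (p d : Fin 4 → ℂ) (f : MvPolynomial (Fin 4) ℂ) :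
    (lineRes p d f).derivative.eval 0 = ∑ i, d i * eval p (pderiv i f) := by
  simp [lineRes_derivative, Polynomial.eval_finsetSum, lineRes_eval]

lemma hom_eval {n : ℕ} {f : MvPolynomial (Fin 4) ℂ} (hf : f.IsHomogeneous n) (t : ℂ)
    (p : Fin 4 → ℂ) : eval (t • p) f = t ^ n * eval p f := by
  rw [eval_eq', eval_eq', Finset.mul_sum]
  refine Finset.sum_congr rfl fun m hm => ?_
  have := hf (mem_support_iff.mp hm)
  rw [← this]
  simp [Finsupp.weight_apply, Finsupp.sum_fintype, mul_pow, Finset.prod_mul_distrib,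
    Finset.prod_pow_eq_pow_sum]
  ring

lemma line_key {n : ℕ} {f : MvPolynomial (Fin 4) ℂ} (hf : f.IsHomogeneous n)
    (p d : Fin 4 → ℂ) (hne : ∀ z : ℂ, eval (p + z • d) f ≠ 0) :
    lineRes d p f = Polynomial.C (eval p f) * Polynomial.X ^ n := by
  have hdeg : (lineRes p d f).degree = 0 := by
    by_contra hd
    obtain ⟨z, hz⟩ := IsAlgClosed.exists_root _ hd
    exact hne z (by rw [← lineRes_eval]; exact hz)
  have hconst : ∀ z : ℂ, eval (p + z • d) f = eval p f := by
    intro z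
    have h0 := lineRes_eval p d f 0
    rw [← lineRes_eval]
    rw [Polynomial.eq_C_of_degree_eq_zero hdeg] at h0 ⊢
    simpa using h0
  apply Polynomial.eq_of_infinite_eval_eq
  refine Set.Infinite.mono (s := {0}ᶜ) ?_ (Set.finite_singleton (0 : ℂ)).infinite_compl
  intro t ht
  have ht : t ≠ 0 := ht
  have e : d + t • p = t • (p + t⁻¹ • d) := by
    rw [smul_add, smul_smul, mul_inv_cancel₀ ht, one_smul, add_comm]
  simp only [Set.mem_ofPred_eq, lineRes_eval, e, hom_eval hf, hconst]
  rw [Polynomial.eval_mul, Polynomial.eval_C, Polynomial.eval_pow, Polynomial.eval_X, mul_comm]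

/-- A hyperplane of `ℙ³` is determined by its intersection with a smooth cubic surface:
if every point of `{s = 0} ∩ {l = 0}` lies on `{l' = 0}`, then `l'` is proportional
to `l`. -/
theorem hyperplane_determined_by_cubic_section
    (s : MvPolynomial (Fin 4) ℂ) (hs : s.IsHomogeneous 3)
    (hsmooth : ∀ p : Fin 4 → ℂ, (∀ i : Fin 4, eval p (pderiv i s) = 0) → p = 0)
    (l l' : (Fin 4 → ℂ) →ₗ[ℂ] ℂ) (hl : l ≠ 0)
    (h : ∀ p : Fin 4 → ℂ, eval p s = 0 → l p = 0 → l' p = 0) :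
    ∃ c : ℂ, l' = c • l := by
  by_contra hcon
  obtain ⟨v, hv⟩ : ∃ v, l v = 1 := by
    obtain ⟨v, hv⟩ : ∃ v, l v ≠ 0 := by
      by_contra! hh
      exact hl (LinearMap.ext hh)
    exact ⟨(l v)⁻¹ • v, by simp [hv]⟩
  obtain ⟨u, hu, hu'⟩ : ∃ u, l u = 0 ∧ l' u = 1 := by
    obtain ⟨u, hu, hu'⟩ : ∃ u, l u = 0 ∧ l' u ≠ 0 := by
      by_contra! hh
      refine hcon ⟨l' v, LinearMap.ext fun x => ?_⟩
      have := hh (x - l x • v) (by simp [hv])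
      simp [sub_eq_zero] at this
      simp [this, mul_comm]
    exact ⟨(l' u)⁻¹ • u, by simp [hu], by simp [hu']⟩
  have key : ∀ w, l w = 0 → l' w = 0 →
      lineRes w u s = Polynomial.C (eval u s) * Polynomial.X ^ 3 := by
    intro w hw hw'
    refine line_key hs u w fun z hz => ?_
    have := h _ hz (by simp [hu, hw])
    simp [hu', hw'] at this
  have hsW : ∀ w, l w = 0 → l' w = 0 → eval w s = 0 := by
    intro w hw hw'
    have := lineRes_eval w u s 0
    rw [key w hw hw'] at this
    simpa using this.symm
  have hDu : ∀ w, l w = 0 → l' w = 0 → ∑ i, u i * eval w (pderiv i s) = 0 := by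
    intro w hw hw'
    rw [← lineRes_deriv_zero, key w hw hw']
    simp
  have hDW : ∀ w, l w = 0 → l' w = 0 → ∀ x, l x = 0 → l' x = 0 →
      ∑ i, x i * eval w (pderiv i s) = 0 := by
    intro w hw hw' x hx hx'
    have : lineRes w x s = 0 := Polynomial.funext fun z => by
      rw [lineRes_eval, hsW _ (by simp [hw, hx]) (by simp [hw', hx'])]; simp
    rw [← lineRes_deriv_zero, this]
    simp
  have fin : ∀ w, l w = 0 → l' w = 0 → ∑ i, v i * eval w (pderiv i s) = 0 → w = 0 := by
    intro w hw hw' hD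
    apply hsmooth
    intro j
    set e : Fin 4 → ℂ := Pi.single j 1 with he
    have h1 := hDW w hw hw' (e - l e • v - (l' e - l e * l' v) • u)
      (by simp [hv, hu]) (by simp [hu'])
    simp only [Pi.sub_apply, Pi.smul_apply, smul_eq_mul, sub_mul, Finset.sum_sub_distrib,
      mul_assoc, ← Finset.mul_sum, hD, hDu w hw hw'] at h1
    simpa [he, Pi.single_apply] using h1
  let W := LinearMap.ker (l.prod l')
  have hrank : 1 < Module.finrank ℂ W := by
    have h1 := LinearMap.finrank_range_add_finrank_ker (l.prod l')
    have h2 := Submodule.finrank_le (LinearMap.range (l.prod l'))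
    simp at h1 h2
    change 1 < Module.finrank ℂ (LinearMap.ker (l.prod l'))
    omega
  have : Nontrivial W := Module.nontrivial_of_finrank_pos (R := ℂ) (by omega)
  obtain ⟨a, ha⟩ := exists_ne (0 : W)
  obtain ⟨b, hab⟩ := exists_linearIndependent_pair_of_one_lt_finrank hrank ha
  have hWm : ∀ x : W, l x = 0 ∧ l' x = 0 := by
    intro x
    have := x.2
    simpa [W, LinearMap.mem_ker] using this
  let g : MvPolynomial (Fin 4) ℂ := ∑ i, C (v i) * pderiv i s
  have hg : g.IsHomogeneous 2 := by
    refine MvPolynomial.IsHomogeneous.sum _ _ _ fun i _ => ?_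
    have := (isHomogeneous_C (Fin 4) (v i)).mul (hs.pderiv (i := i))
    simpa using this
  have hge : ∀ w, eval w g = ∑ i, v i * eval w (pderiv i s) := by
    intro w; simp [g]
  by_cases hz : ∃ z : ℂ, eval ((b : Fin 4 → ℂ) + z • (a : Fin 4 → ℂ)) g = 0
  · obtain ⟨z, hz⟩ := hz
    have h0 := fin ((b : Fin 4 → ℂ) + z • (a : Fin 4 → ℂ)) (by simp [hWm]) (by simp [hWm])
      (by rw [← hge, hz])
    have h0' : z • a + (1 : ℂ) • b = 0 := by
      apply Subtype.ext
      simpa [add_comm] using h0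
    have := (LinearIndependent.pair_iff.mp hab z 1 h0').2
    exact one_ne_zero this
  · push Not at hz
    have hk := line_key hg _ _ hz
    have h0 := lineRes_eval (a : Fin 4 → ℂ) b g 0
    rw [hk] at h0
    have : (a : Fin 4 → ℂ) = 0 := fin a (hWm a).1 (hWm a).2 (by
      rw [← hge]; simpa using h0.symm)
    exact ha (Subtype.ext this)
end

section
/- Let ℂ[x₀,x₁,x₂,x₃] be graded by positive integer weights (1, a₁, a₂, a₃) (the first weight equal to 1), let e ≥ 2, and let s be weighted homogeneous of degree e whose four partial derivatives have the origin as their only common zero in ℂ⁴. Then the set of α ∈ ℂ for which the four partial derivatives of s − α·x₀^e have a common zero in ℂ⁴ ∖ {0} is finite. (All but finitely many members of the pencil generated by S = {s = 0} and e·H, H = {x₀ = 0}, are smooth hypersurfaces of the weighted projective space — the assertion of §1.1.1 that the general member of ℒ is a smooth del Pezzo surface.) -/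
open MvPolynomial

section helpers

attribute [local instance] MvPolynomial.weightedGradedAlgebra

/-- Homogeneous component of a multiple of a homogeneous polynomial. -/
lemma comp_mul_homog (w : Fin 4 → ℕ) (d k : ℕ) (g h : MvPolynomial (Fin 4) ℂ)
    (hh : h.IsWeightedHomogeneous w k) :
    weightedHomogeneousComponent w d (g * h) =
      if k ≤ d then weightedHomogeneousComponent w (d - k) g * h else 0 := by
  simp_rw [← weightedDecomposition.decompose'_apply]
  exact DirectSum.coe_decompose_mul_of_right_mem (weightedHomogeneousSubmodule ℂ w) d
    ((mem_weightedHomogeneousSubmodule ℂ w k h).2 hh)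

end helpers

lemma eval_scale (w : Fin 4 → ℕ) (d : ℕ) (f : MvPolynomial (Fin 4) ℂ)
    (hf : f.IsWeightedHomogeneous w d) (c : ℂ) (p : Fin 4 → ℂ) :
    eval (fun i => c ^ w i * p i) f = c ^ d * eval p f := by
  rw [eval_eq', eval_eq', Finset.mul_sum]
  refine Finset.sum_congr rfl fun m hm => ?_
  have h1 : Finsupp.weight w m = d := hf (mem_support_iff.1 hm)
  rw [Finsupp.weight_apply, Finsupp.sum_fintype _ _ (by simp)] at h1
  simp_rw [mul_pow, Finset.prod_mul_distrib, ← pow_mul, Finset.prod_pow_eq_pow_sum]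
  have : ∑ i, w i * m i = d := by rw [← h1]; simp [mul_comm]
  rw [this]; ring

lemma homog_pderiv (w : Fin 4 → ℕ) (e : ℕ) (s : MvPolynomial (Fin 4) ℂ)
    (hs : s.IsWeightedHomogeneous w e) (i : Fin 4) :
    (pderiv i s).IsWeightedHomogeneous w (e - w i) := by
  by_cases h : w i ≤ e
  · exact hs.pderiv (by omega)
  · have : pderiv i s = 0 := by
      apply pderiv_eq_zero_of_notMem_vars
      rw [mem_vars_iff_mem_support]
      rintro ⟨m, hm, hi⟩
      have h1 : Finsupp.weight w m = e := hs (mem_support_iff.1 hm)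
      have h2 : w i ≤ Finsupp.weight w m := Finsupp.le_weight_of_ne_zero' w (Finsupp.mem_support_iff.1 hi)
      omega
    rw [this]; exact isWeightedHomogeneous_zero ℂ w _

lemma nullst (h : Fin 4 → MvPolynomial (Fin 4) ℂ)
    (hz : ∀ p : Fin 4 → ℂ, (∀ i, eval p (h i) = 0) → p = 0) :
    ∃ N : ℕ, ∀ i, (X i : MvPolynomial (Fin 4) ℂ) ^ N ∈ Ideal.span (Set.range h) := by
  have h1 : ∀ i, ∃ n : ℕ, (X i : MvPolynomial (Fin 4) ℂ) ^ n ∈ Ideal.span (Set.range h) := by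
    intro i
    have : (X i : MvPolynomial (Fin 4) ℂ) ∈ (Ideal.span (Set.range h)).radical := by
      rw [← vanishingIdeal_zeroLocus_eq_radical (K := ℂ), mem_vanishingIdeal_iff]
      intro p hp
      have : p = 0 := hz p fun j => by
        have := hp (h j) (Ideal.subset_span ⟨j, rfl⟩)
        simpa [aeval_eq_eval] using this
      simp [this]
    exact this
  choose n hn using h1
  refine ⟨∑ i, n i, fun i => ?_⟩
  exact Ideal.pow_mem_of_pow_mem _ (hn i) (Finset.single_le_sum (f := n) (fun _ _ => Nat.zero_le _) (Finset.mem_univ i))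

lemma key_rel (w : Fin 4 → ℕ) (h : Fin 4 → MvPolynomial (Fin 4) ℂ) (k : Fin 4 → ℕ)
    (hh : ∀ i, (h i).IsWeightedHomogeneous w (k i)) (hk : 0 < k 0)
    (hz : ∀ p : Fin 4 → ℂ, (∀ i, eval p (h i) = 0) → p = 0) :
    ∃ P : Polynomial (Polynomial ℂ), P.Monic ∧ ∀ p : Fin 4 → ℂ, (∀ i, i ≠ 0 → eval p (h i) = 0) →
      Polynomial.eval₂ (Polynomial.evalRingHom (eval p (h 0))) (p 0) P = 0 := by
  obtain ⟨N, hN⟩ := nullst h hz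
  set J : Ideal (MvPolynomial (Fin 4) ℂ) := Ideal.span (h '' {i | i ≠ 0}) with hJ
  let q := Ideal.Quotient.mk J
  let φ : Polynomial ℂ →+* (MvPolynomial (Fin 4) ℂ ⧸ J) :=
    Polynomial.eval₂RingHom (q.comp C) (q (h 0))
  have hfin : φ.Finite := by
    letI := φ.toAlgebra
    let B : Set (Fin 4 →₀ ℕ) := Set.Iic (Finsupp.equivFunOnFinite.symm fun _ => N)
    have hB : B.Finite := Set.finite_Iic _
    let T : Submodule (Polynomial ℂ) (MvPolynomial (Fin 4) ℂ ⧸ J) :=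
      Submodule.span _ ((fun m => q (monomial m 1)) '' B)
    have hC : ∀ (c : ℂ) f, q f ∈ T → q (C c * f) ∈ T := by
      intro c f hf
      have : q (C c * f) = (Polynomial.C c : Polynomial ℂ) • q f := by
        rw [Algebra.smul_def]
        change _ = φ _ * _
        simp [φ]
      rw [this]; exact T.smul_mem _ hf
    have ht : ∀ f, q f ∈ T → q (f * h 0) ∈ T := by
      intro f hf
      have : q (f * h 0) = (Polynomial.X : Polynomial ℂ) • q f := by
        rw [Algebra.smul_def]
        change _ = φ _ * _
        simp [φ, mul_comm]
      rw [this]; exact T.smul_mem _ hf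
    have hsum : ∀ f : MvPolynomial (Fin 4) ℂ,
        (∀ m ∈ f.support, q (monomial m 1) ∈ T) → q f ∈ T := by
      intro f hf
      rw [f.as_sum, map_sum]
      refine T.sum_mem fun m hm => ?_
      have := hC (f.coeff m) _ (hf m hm)
      rwa [C_mul_monomial, mul_one] at this
    have hmon : ∀ d : ℕ, ∀ m : Fin 4 →₀ ℕ, Finsupp.weight w m = d → q (monomial m 1) ∈ T := by
      intro d
      induction d using Nat.strong_induction_on with
      | _ d ih =>
        intro m hm
        by_cases hmB : m ∈ B
        · exact Submodule.subset_span ⟨m, hmB, rfl⟩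
        obtain ⟨i, hi⟩ : ∃ i, N < m i := by
          by_contra! hcon
          exact hmB fun i => by simpa using hcon i
        have hI : (monomial m (1 : ℂ)) ∈ Ideal.span (Set.range h) := by
          have : (monomial m (1 : ℂ)) = monomial (m - Finsupp.single i N) 1 * X i ^ N := by
            rw [X_pow_eq_monomial, monomial_mul, mul_one,
              tsub_add_cancel_of_le (Finsupp.single_le_iff.2 hi.le)]
          rw [this]; exact Ideal.mul_mem_left _ _ (hN i)
        obtain ⟨g, hg⟩ := (Ideal.mem_span_range_iff_exists_fun).1 hI
        have hcomp : monomial m (1 : ℂ) =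
            ∑ j, weightedHomogeneousComponent w d (g j * h j) := by
          rw [← map_sum, hg]
          exact ((isWeightedHomogeneous_monomial w m (1 : ℂ) hm).weightedHomogeneousComponent_same).symm
        rw [hcomp, map_sum]
        refine T.sum_mem fun j _ => ?_
        rw [comp_mul_homog w d (k j) _ _ (hh j)]
        split_ifs with hle
        · by_cases hj : j = 0
          · subst hj
            apply ht
            apply hsum
            intro m' hm'
            refine ih (d - k 0) (by omega) m' ?_
            exact weightedHomogeneousComponent_isWeightedHomogeneous (d - k 0) (g 0)
              (mem_support_iff.1 hm')
          · have : q (weightedHomogeneousComponent w (d - k j) (g j) * h j) = 0 :=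
              Ideal.Quotient.eq_zero_iff_mem.2
                (Ideal.mul_mem_left _ _ (Ideal.subset_span ⟨j, hj, rfl⟩))
            rw [this]; exact T.zero_mem
        · rw [map_zero]; exact T.zero_mem
    have htop : T = ⊤ := by
      rw [eq_top_iff]
      rintro x -
      obtain ⟨f, rfl⟩ := Ideal.Quotient.mk_surjective x
      exact hsum f fun m _ => hmon _ m rfl
    exact ⟨htop ▸ Submodule.fg_span (hB.image _)⟩
  obtain ⟨P, hP, hP0⟩ := hfin.to_isIntegral (q (X 0))
  refine ⟨P, hP, fun p hp => ?_⟩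
  let ψ : (MvPolynomial (Fin 4) ℂ ⧸ J) →+* ℂ := Ideal.Quotient.lift J (eval p) (by
    intro a ha
    have : J ≤ RingHom.ker (eval p) := by
      rw [hJ, Ideal.span_le]
      rintro _ ⟨i, hi, rfl⟩
      exact hp i hi
    exact this ha)
  have hψ : ∀ f, ψ (q f) = eval p f := fun f => rfl
  have h1 := congrArg ψ hP0
  rw [Polynomial.hom_eval₂, map_zero] at h1
  have h2 : ψ.comp φ = Polynomial.evalRingHom (eval p (h 0)) := by
    apply Polynomial.ringHom_ext
    · intro a; simp [φ, hψ]
    · simp [φ, hψ]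
  have h3 : ψ (q (X 0)) = p 0 := by simp [hψ]
  rwa [h2, h3] at h1

/-- All but finitely many members of the pencil generated by `S = {s = 0}` and `e·H`,
`H = {x₀ = 0}`, are smooth (quasi-smooth) hypersurfaces of the weighted projective
space `ℙ(1, a₁, a₂, a₃)`. -/
theorem general_member_of_pencil_smooth
    (w : Fin 4 → ℕ) (hw0 : w 0 = 1) (hwpos : ∀ i, 0 < w i)
    (e : ℕ) (he : 2 ≤ e)
    (s : MvPolynomial (Fin 4) ℂ) (hs : s.IsWeightedHomogeneous w e)
    (hsmooth : ∀ p : Fin 4 → ℂ, (∀ i : Fin 4, eval p (pderiv i s) = 0) → p = 0) :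
    {α : ℂ | ∃ p : Fin 4 → ℂ,
      p ≠ 0 ∧ ∀ i : Fin 4, eval p (pderiv i (s - C α * X 0 ^ e)) = 0}.Finite := by
  obtain ⟨P, hP, hPz⟩ := key_rel w (fun i => pderiv i s) (fun i => e - w i)
    (homog_pderiv w e s hs) (by simp only [hw0]; omega) hsmooth
  have he0 : (e : ℂ) ≠ 0 := by exact_mod_cast (by omega : e ≠ 0)
  by_contra hinf
  -- the relation holds along every scaled singular point
  have hA : ∀ α ∈ {α : ℂ | ∃ p : Fin 4 → ℂ,
      p ≠ 0 ∧ ∀ i : Fin 4, eval p (pderiv i (s - C α * X 0 ^ e)) = 0}, ∀ μ : ℂ,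
      Polynomial.eval₂ (Polynomial.evalRingHom (e * α * μ ^ (e - 1))) μ P = 0 := by
    rintro α ⟨p, hp, hpz⟩ μ
    have h0 : eval p (pderiv 0 s) = e * α * p 0 ^ (e - 1) := by
      have := hpz 0
      simp only [map_sub, pderiv_C_mul, pderiv_pow, pderiv_X_self, map_mul, eval_C, map_natCast,
        map_pow, eval_X, map_one, mul_one] at this
      linear_combination this
    have hi : ∀ i, i ≠ 0 → eval p (pderiv i s) = 0 := by
      intro i hi
      have := hpz i
      simpa [pderiv_C_mul, pderiv_pow, pderiv_X_of_ne hi.symm] using this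
    have hp0 : p 0 ≠ 0 := by
      intro h
      apply hp
      apply hsmooth
      intro i
      by_cases hi0 : i = 0
      · subst hi0
        rw [h0, h, zero_pow (by omega), mul_zero]
      · exact hi i hi0
    have := hPz (fun i => (μ / p 0) ^ w i * p i) (by
      intro i hi0
      rw [eval_scale w _ _ (homog_pderiv w e s hs i), hi i hi0, mul_zero])
    rw [eval_scale w _ _ (homog_pderiv w e s hs 0), h0, hw0, pow_one, div_mul_cancel₀ _ hp0] at this
    have hq : (μ / p 0) ^ (e - 1) * (e * α * p 0 ^ (e - 1)) = e * α * μ ^ (e - 1) := by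
      rw [div_pow]; field_simp
    rwa [hq] at this
  have hB : ∀ μ : ℂ, μ ≠ 0 → Polynomial.eval₂ (Polynomial.evalRingHom 0) μ P = 0 := by
    intro μ hμ
    -- swap: evaluate the outer variable at the constant μ
    have hsw : ∀ t : ℂ, Polynomial.eval₂ (Polynomial.evalRingHom t) μ P =
        (P.eval (Polynomial.C μ)).eval t := by
      intro t
      rw [← Polynomial.coe_evalRingHom t, ← Polynomial.eval₂_id (p := P), Polynomial.hom_eval₂]
      simp
    have hz : P.eval (Polynomial.C μ) = 0 := by
      apply Polynomial.eq_zero_of_infinite_isRoot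
      have hinj : Function.Injective (fun α : ℂ => e * α * μ ^ (e - 1)) := by
        intro a b hab
        have hm : μ ^ (e - 1) ≠ 0 := pow_ne_zero _ hμ
        simpa [he0, hm, hμ] using hab
      refine ((Set.not_finite.1 hinf).image hinj.injOn).mono ?_
      rintro _ ⟨α, hα, rfl⟩
      change Polynomial.eval _ _ = 0
      rw [← hsw]
      exact hA α hα μ
    rw [hsw, hz, Polynomial.eval_zero]
  have hM : (P.map (Polynomial.evalRingHom (0 : ℂ))).Monic := hP.map _
  apply hM.ne_zero
  apply Polynomial.eq_zero_of_infinite_isRoot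
  refine (Set.Finite.infinite_compl (Set.finite_singleton (0 : ℂ))).mono ?_
  intro μ hμ
  change Polynomial.eval _ _ = 0
  rw [Polynomial.eval_map]
  exact hB μ hμ
end

section
/- Let s ∈ ℂ[x₀,x₁,x₂,x₃] be a homogeneous polynomial of degree 3 such that the only common zero in ℂ⁴ of its four partial derivatives is the origin. For each j ∈ {0,1,2,3}, let F_j ∈ ℂ[u₀,u₁,u₂,λ] be the polynomial obtained from s(x₀,x₁,x₂,x₃) − λ·x₀³ by substituting x_j = 1 and renaming the remaining three variables x_i (i ≠ j, in order) as u₀, u₁, u₂. Then there is no point p ∈ ℂ⁴ at which F_j and all four of its partial derivatives vanish simultaneously. (The total space X = {β·s − α·x₀³ = 0} ⊂ ℙ³ × ℙ¹ of the blow-up of the base locus of the pencil is smooth away from the fiber over ∞ = [1:0] — the smoothness assertion used in §2 to construct good resolutions.) -/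
open MvPolynomial

/-- Chain rule for evaluated partial derivatives of a substitution. -/
theorem eval_pderiv_aeval_chain (f : Fin 4 → MvPolynomial (Fin 4) ℂ) (p : Fin 4 → ℂ) (k : Fin 4)
    (s : MvPolynomial (Fin 4) ℂ) :
    eval p (pderiv k (aeval f s)) =
      ∑ i, eval (fun i => eval p (f i)) (pderiv i s) * eval p (pderiv k (f i)) := by
  have hE : ∀ a : MvPolynomial (Fin 4) ℂ,
      eval p (aeval f a) = eval (fun i => eval p (f i)) a := by
    intro a
    induction a using MvPolynomial.induction_on with
    | C a => simp [algebraMap_eq]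
    | add a b ha hb => simp only [map_add, ha, hb]
    | mul_X a i ha => simp only [map_mul, ha, aeval_X, eval_X]
  induction s using MvPolynomial.induction_on with
  | C a => simp [algebraMap_eq]
  | add a b ha hb => simp only [map_add, ha, hb, add_mul, Finset.sum_add_distrib]
  | mul_X a j ha =>
    simp only [map_mul, Derivation.leibniz, smul_eq_mul, map_add, aeval_X, ha, hE, pderiv_X,
      add_mul, Finset.sum_add_distrib, eval_X]
    congr 1
    · rw [Finset.sum_eq_single j]
      · simp
      · intro b _ hb
        simp [Pi.single_apply, hb.symm]
      · simp
    · rw [Finset.mul_sum]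
      exact Finset.sum_congr rfl fun i _ => by ring

/-- The total space `X = {β·s − α·x₀³ = 0} ⊂ ℙ³ × ℙ¹` of the blow-up of the base locus
of the pencil generated by a smooth cubic `S = {s = 0}` and `3H`, `H = {x₀ = 0}`, is
smooth away from the fiber over `∞`: in each affine chart `x_j = 1` (with the
remaining variables renamed, in order, as `u₀, u₁, u₂`, and with `λ` the affine
coordinate on `ℙ¹ ∖ {∞}` as fourth variable), the affine hypersurface `{F_j = 0}`
has no point where `F_j` and all four of its partial derivatives vanish. -/
theorem blowup_total_space_smooth_away_from_infinity
    (s : MvPolynomial (Fin 4) ℂ) (hs : s.IsHomogeneous 3)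
    (hsmooth : ∀ p : Fin 4 → ℂ, (∀ i : Fin 4, eval p (pderiv i s) = 0) → p = 0)
    (subst : Fin 4 → Fin 4 → MvPolynomial (Fin 4) ℂ)
    (hsubst : ∀ j i, subst j i =
      if h : i = j then 1
      else X (Fin.castSucc ((finSuccAboveEquiv j).symm ⟨i, h⟩)))
    (F : Fin 4 → MvPolynomial (Fin 4) ℂ)
    (hF : ∀ j, F j = aeval (subst j) s - X 3 * (subst j 0) ^ 3) :
    ∀ j : Fin 4, ¬ ∃ p : Fin 4 → ℂ,
      eval p (F j) = 0 ∧ ∀ i : Fin 4, eval p (pderiv i (F j)) = 0 := by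
  rintro j ⟨p, h0, hd⟩
  have hj : subst j j = 1 := by rw [hsubst]; simp
  have hk : ∀ k : Fin 3, subst j (j.succAbove k) = X (Fin.castSucc k) := by
    intro k
    rw [hsubst, dif_neg (Fin.succAbove_ne j k)]
    congr 2
    rw [Equiv.symm_apply_eq]
    rfl
  have h3 : ∀ i, pderiv 3 (subst j i) = 0 := by
    intro i
    rcases Fin.eq_self_or_eq_succAbove j i with rfl | ⟨k, rfl⟩
    · rw [hj]; simp
    · rw [hk, pderiv_X_of_ne]
      exact (Fin.castSucc_lt_last k).ne
  have hE : ∀ a : MvPolynomial (Fin 4) ℂ,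
      eval p (aeval (subst j) a) = eval (fun i => eval p (subst j i)) a := by
    intro a
    induction a using MvPolynomial.induction_on with
    | C a => simp [algebraMap_eq]
    | add a b ha hb => simp only [map_add, ha, hb]
    | mul_X a i ha => simp only [map_mul, ha, aeval_X, eval_X]
  have q0 : eval p (subst j 0) = 0 := by
    have h := hd 3
    rw [hF, map_sub, map_sub, eval_pderiv_aeval_chain] at h
    simpa [h3, Derivation.leibniz_pow] using h
  have hs0 : eval (fun i => eval p (subst j i)) s = 0 := by
    rw [hF, map_sub, hE] at h0
    simpa [q0] using h0
  have hdk : ∀ k : Fin 3, eval (fun i => eval p (subst j i)) (pderiv (j.succAbove k) s) = 0 := by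
    intro k
    have h := hd k.castSucc
    rw [hF, map_sub, map_sub, eval_pderiv_aeval_chain, Fin.sum_univ_succAbove _ j] at h
    simp only [hj, hk, pderiv_X] at h
    rw [Finset.sum_eq_single k] at h
    · simpa [q0, Derivation.leibniz_pow] using h
    · intro b _ hb
      simp [Pi.single_apply, hb.symm]
    · simp
  have hdj : eval (fun i => eval p (subst j i)) (pderiv j s) = 0 := by
    have h := congrArg (eval (fun i => eval p (subst j i))) hs.sum_X_mul_pderiv
    rw [Fin.sum_univ_succAbove _ j] at h
    simpa [hdk, hs0, hj] using h
  have hz := hsmooth (fun i => eval p (subst j i)) (by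
    intro i
    rcases Fin.eq_self_or_eq_succAbove j i with rfl | ⟨k, rfl⟩
    · exact hdj
    · exact hdk k)
  have := congrFun hz j
  simp [hj] at this
end

section
/- Let K = ℂ(λ, v) be the field of rational functions in two variables λ, v over ℂ. Then the quotient K-algebra K[Y,W]/(v²·W² + Y² + W + v⁶ − λ) is isomorphic, as a K-algebra, to the Laurent polynomial ring K[U, U⁻¹]. (After the quadratic base change z = v², the generic fiber of the fibration ξ₀ = (f, pr_z) : 𝔸³ → 𝔸², f(y,z,w) = w²z + y² + w + z³, becomes the punctured affine line — the base-change computation of Example 4.4.) -/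
open MvPolynomial

/-- `K = ℂ(λ, v)`, the field of rational functions in two variables over ℂ,
realized as the fraction field of `ℂ[λ][v]`. -/
abbrev Kfield : Type := FractionRing (Polynomial (Polynomial ℂ))

/-- The rational function `λ` (the first variable). -/
noncomputable def lam : Kfield :=
  algebraMap (Polynomial (Polynomial ℂ)) Kfield (Polynomial.C Polynomial.X)

/-- The rational function `v` (the second variable). -/
noncomputable def vv : Kfield :=
  algebraMap (Polynomial (Polynomial ℂ)) Kfield Polynomial.X

/-- The relation satisfied by the images of `T` and `T⁻¹`. -/
lemma aux_rel {A : Type*} [CommRing A] {v l i h u c t s : A} (hi : i * i = -1) (hh : h * 2 = 1)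
    (hu : u * v = 1) (hl : l = c + v ^ 6 - h ^ 2 * u ^ 2) (ts : t * s = 1) :
    v ^ 2 * (u * (h * (t + c * s) - h * u)) ^ 2 + (-i * h * (t - c * s)) ^ 2
      + u * (h * (t + c * s) - h * u) + v ^ 6 - l = 0 := by
  subst hl
  grind

lemma aux_t {A : Type*} [CommRing A] {v i h u c t s : A} (hi : i * i = -1) (hh : h * 2 = 1)
    (hu : u * v = 1) :
    v * (u * (h * (t + c * s) - h * u)) + h * u + i * (-i * h * (t - c * s)) = t := by
  linear_combination (h * (t + c * s) - h * u) * hu - h * (t - c * s) * hi + t * hh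

lemma aux_y {A : Type*} [CommRing A] {i h c d y z : A} (hi : i * i = -1) (hh : h * 2 = 1)
    (hc : c * d = 1) :
    -i * h * (z + i * y - c * (d * (z - i * y))) = y := by
  linear_combination i * h * (z - i * y) * hc - 2 * h * y * hi + y * hh

lemma aux_w {A : Type*} [CommRing A] {v h u c d w x : A} (hh : h * 2 = 1)
    (hu : u * v = 1) (hc : c * d = 1) :
    u * (h * (v * w + h * u + x + c * (d * (v * w + h * u - x))) - h * u) = w := by
  linear_combination u * h * (v * w + h * u - x) * hc + (u * v * w + h * u ^ 2) * hh + w * hu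

/-- A general form over a field. -/
lemma aux_equiv {K : Type*} [Field K] (v l i h u c d : K) (hi : i * i = -1) (hh : h * 2 = 1)
    (hu : u * v = 1) (hl : l = c + v ^ 6 - h ^ 2 * u ^ 2) (hc : c * d = 1) :
    Nonempty ((MvPolynomial (Fin 2) K ⧸
        Ideal.span ({C (v ^ 2) * X 1 ^ 2 + X 0 ^ 2 + X 1 + C (v ^ 6) - C l} :
          Set (MvPolynomial (Fin 2) K)))
      ≃ₐ[K] LaurentPolynomial K) := by
  set I : Ideal (MvPolynomial (Fin 2) K) :=
    Ideal.span {C (v ^ 2) * X 1 ^ 2 + X 0 ^ 2 + X 1 + C (v ^ 6) - C l} with hI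
  have key : ∀ {A : Type _} [CommRing A] [Algebra K A],
      let m := algebraMap K A
      m i * m i = -1 ∧ m h * 2 = 1 ∧ m u * m v = 1 ∧
      m l = m c + m v ^ 6 - m h ^ 2 * m u ^ 2 ∧ m c * m d = 1 := by
    intro A _ _ m
    refine ⟨?_, ?_, ?_, ?_, ?_⟩
    · rw [← map_mul, hi]; simp
    · have := congrArg m hh
      rwa [map_mul, map_one, map_ofNat] at this
    · rw [← map_mul, hu, map_one]
    · rw [hl]; simp
    · rw [← map_mul, hc, map_one]
  let P : Type _ := MvPolynomial (Fin 2) K ⧸ I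
  let L := LaurentPolynomial K
  let t : L := LaurentPolynomial.T 1
  let s : L := LaurentPolynomial.T (-1)
  have ts : t * s = 1 := by
    change (LaurentPolynomial.T 1 : LaurentPolynomial K) * LaurentPolynomial.T (-1) = 1
    rw [← LaurentPolynomial.T_add, add_neg_cancel, LaurentPolynomial.T_zero]
  obtain ⟨li, lh, lu, ll, lc⟩ := key (A := L)
  obtain ⟨qi, qh, qu, ql, qc⟩ := key (A := P)
  let m := algebraMap K L
  let q := algebraMap K P
  let y0 : L := -m i * m h * (t - m c * s)
  let w0 : L := m u * (m h * (t + m c * s) - m h * m u)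
  let F0 : MvPolynomial (Fin 2) K →ₐ[K] L := aeval ![y0, w0]
  have hF0 : ∀ a ∈ I, F0 a = 0 := by
    intro a ha
    have : I ≤ RingHom.ker F0 := by
      rw [hI, Ideal.span_singleton_le_iff_mem, RingHom.mem_ker]
      have := aux_rel li lh lu ll ts
      simpa [F0, y0, w0, m, algHom_C] using this
    exact this ha
  let F : P →ₐ[K] L := Ideal.Quotient.liftₐ I F0 hF0
  let y : P := Ideal.Quotient.mk I (X 0)
  let w : P := Ideal.Quotient.mk I (X 1)
  have rel : q v ^ 2 * w ^ 2 + y ^ 2 + w + q v ^ 6 - q l = 0 := by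
    have h0 : Ideal.Quotient.mk I
        (C (v ^ 2) * X 1 ^ 2 + X 0 ^ 2 + X 1 + C (v ^ 6) - C l) = 0 := by
      rw [Ideal.Quotient.eq_zero_iff_mem, hI]
      exact Ideal.mem_span_singleton_self _
    have hq : ∀ x, q x = Ideal.Quotient.mk I (C x) := fun _ => rfl
    rw [← h0, hq, hq]
    simp [y, w]
  let g : P := q v * w + q h * q u + q i * y
  let g' : P := q d * (q v * w + q h * q u - q i * y)
  have gg : g * g' = 1 := by
    change q i * q i = -1 at qi
    change q h * 2 = 1 at qh
    change q u * q v = 1 at qu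
    change q l = _ at ql
    change q c * q d = 1 at qc
    change q l = q c + q v ^ 6 - q h ^ 2 * q u ^ 2 at ql
    have e : (q v * w + q h * q u + q i * y) * (q v * w + q h * q u - q i * y) = q c := by
      linear_combination rel - y ^ 2 * qi + w * q h * 2 * qu + w * qh + ql
    simp only [g, g']
    linear_combination q d * e + qc
  let U : Pˣ := ⟨g, g', gg, by rw [mul_comm, gg]⟩
  let G : L →ₐ[K] P := AddMonoidAlgebra.lift K P ℤ ((Units.coeHom P).comp (zpowersHom Pˣ U))
  have Gt : G t = g := by
    refine (AddMonoidAlgebra.lift_single _ (1 : ℤ) (1 : K)).trans ?_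
    simp [U]
  have Gs : G s = g' := by
    refine (AddMonoidAlgebra.lift_single _ (-1 : ℤ) (1 : K)).trans ?_
    simp [U]
  have Fy : F y = y0 := by
    change F0 (X 0) = y0
    simp [F0]
  have Fw : F w = w0 := by
    change F0 (X 1) = w0
    simp [F0]
  have Gm : ∀ x, G (m x) = q x := fun x => G.commutes x
  have Fq : ∀ x, F (q x) = m x := fun x => F.commutes x
  change m i * m i = -1 at li
  change m h * 2 = 1 at lh
  change m u * m v = 1 at lu
  change m c * m d = 1 at lc
  change q i * q i = -1 at qi
  change q h * 2 = 1 at qh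
  change q u * q v = 1 at qu
  change q c * q d = 1 at qc
  have Fg : F g = t := by
    simp only [g, map_add, map_mul, Fq, Fy, Fw, y0, w0]
    exact aux_t li lh lu
  refine ⟨AlgEquiv.ofAlgHom F G ?_ ?_⟩
  · refine AddMonoidAlgebra.algHom_ext' ?_ (Subsingleton.elim _ _)
    refine MonoidHom.ext_mint ?_
    have : F (G t) = t := by rw [Gt, Fg]
    exact this
  · refine Ideal.Quotient.algHom_ext _ (MvPolynomial.algHom_ext ?_)
    intro j
    fin_cases j
    · change G (F y) = y
      rw [Fy]
      simp only [y0, map_add, map_sub, map_neg, map_mul, Gm, Gt, Gs, g, g']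
      exact aux_y qi qh qc
    · change G (F w) = w
      rw [Fw]
      simp only [w0, map_add, map_sub, map_neg, map_mul, Gm, Gt, Gs, g, g']
      exact aux_w qh qu qc

lemma aux_vv : vv ≠ 0 := by
  unfold vv
  rw [Ne, FaithfulSMul.algebraMap_eq_zero_iff]
  exact Polynomial.X_ne_zero

lemma aux_c : 4 * vv ^ 2 * lam - 4 * vv ^ 8 + 1 ≠ 0 := by
  unfold vv lam
  intro h
  have h1 : algebraMap (Polynomial (Polynomial ℂ)) Kfield
      (4 * Polynomial.X ^ 2 * Polynomial.C Polynomial.X - 4 * Polynomial.X ^ 8 + 1) = 0 := by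
    rw [← h]
    simp only [map_add, map_sub, map_mul, map_pow, map_one, map_ofNat]
  rw [FaithfulSMul.algebraMap_eq_zero_iff] at h1
  have h2 := congrArg (Polynomial.eval 0) h1
  simp at h2

lemma aux_i : ∃ i : Kfield, i * i = -1 :=
  ⟨algebraMap (Polynomial (Polynomial ℂ)) Kfield (Polynomial.C (Polynomial.C Complex.I)), by
    rw [← map_mul, ← Polynomial.C_mul, ← Polynomial.C_mul, Complex.I_mul_I]; simp⟩

/-- After the quadratic base change `z = v²`, the generic fiber of
`ξ₀ = (f, pr_z) : 𝔸³ → 𝔸²`, `f(y,z,w) = w²z + y² + w + z³`, becomes the punctured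
affine line: `K[Y,W]/(v²·W² + Y² + W + v⁶ − λ)` is `K`-isomorphic to the Laurent
polynomial ring `K[U, U⁻¹]` (here `Y = X 0`, `W = X 1`). -/
theorem base_changed_generic_fiber_is_punctured_line :
    Nonempty ((MvPolynomial (Fin 2) Kfield ⧸
        Ideal.span ({C (vv ^ 2) * X 1 ^ 2 + X 0 ^ 2 + X 1 + C (vv ^ 6) - C lam} :
          Set (MvPolynomial (Fin 2) Kfield)))
      ≃ₐ[Kfield] LaurentPolynomial Kfield) := by
  obtain ⟨i, hi⟩ := aux_i
  have hv := aux_vv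
  have h2 : (2 : Kfield) ≠ 0 := two_ne_zero
  have hc : lam - vv ^ 6 + (2⁻¹) ^ 2 * (vv⁻¹) ^ 2 ≠ 0 := by
    intro h
    apply aux_c
    have e : 4 * vv ^ 2 * lam - 4 * vv ^ 8 + 1
        = 4 * vv ^ 2 * (lam - vv ^ 6 + (2⁻¹) ^ 2 * (vv⁻¹) ^ 2) := by
      field_simp
      ring
    rw [e, h, mul_zero]
  exact aux_equiv vv lam i 2⁻¹ vv⁻¹ _ _ hi (inv_mul_cancel₀ h2) (inv_mul_cancel₀ hv)
    (by ring) (mul_inv_cancel₀ hc)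
end
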